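/- arXiv:0810.1877 — 4 statements merged into one kernel-verified Lean document; each statement's English description precedes it below -/
import Mathlib

section
/- Let A be a commutative local ℚ_p-algebra with maximal ideal m_A and residue field k = A/m_A, and let I ⊆ A be an ideal with I·m_A = 0. Let D_{A/I} be a (φ,N,G)-module over A/I and set D_k = D_{A/I} ⊗_{A/I} k, a (φ,N,G)-module over k. If H²(D_k) = 0 (that is, every G-equivariant k-linear endomorphism h of D_k can be written h = (N∘f − f∘N) + (q·φ∘g∘φ^{-1} − g) with f, g G-equivariant k-linear endomorphisms of D_k), then there exists a (φ,N,G)-module D_A over A together with an isomorphism of (φ,N,G)-modules D_A ⊗_A (A/I) ≅ D_{A/I}, i.e. an A/I-linear isomorphism commuting with the G-actions and with the operators φ and N. -/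
/-- A `(φ,N,G)`-module over a commutative ring `R`, relative to a scalar `q : R`, a finite
group `G` and an automorphism `θ` of `G`: a finite free `R`-module `D` with an `R`-linear
`G`-action `ρ`, a nilpotent `R`-linear operator `N` commuting with the `G`-action, and an
`R`-linear automorphism `φ` with `N ∘ φ = q • (φ ∘ N)` and `φ ∘ ρ(γ) ∘ φ⁻¹ = ρ(θ γ)`. -/
structure PhiNGModule (R : Type) [CommRing R] (q : R) (G : Type) [Group G] (θ : G ≃* G) where
  D : Type
  [iAdd : AddCommGroup D]
  [iMod : Module R D]
  [iFree : Module.Free R D]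
  [iFin : Module.Finite R D]
  ρ : G →* (D ≃ₗ[R] D)
  N : D →ₗ[R] D
  nilpotent_N : IsNilpotent N
  comm_N_ρ : ∀ γ : G, N ∘ₗ ((ρ γ : D ≃ₗ[R] D) : D →ₗ[R] D) = ((ρ γ : D ≃ₗ[R] D) : D →ₗ[R] D) ∘ₗ N
  φ : D ≃ₗ[R] D
  rel_N_φ : N ∘ₗ (φ : D →ₗ[R] D) = q • ((φ : D →ₗ[R] D) ∘ₗ N)
  rel_φ_ρ : ∀ γ : G, (φ : D →ₗ[R] D) ∘ₗ ((ρ γ : D ≃ₗ[R] D) : D →ₗ[R] D) ∘ₗ (φ.symm : D →ₗ[R] D)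
      = ((ρ (θ γ) : D ≃ₗ[R] D) : D →ₗ[R] D)

attribute [instance] PhiNGModule.iAdd PhiNGModule.iMod PhiNGModule.iFree PhiNGModule.iFin

section SquareZeroLifting

variable {E F : Type*} [Ring E] [Ring F] {r : E →+* F}

/-- Units lift along a surjection of (noncommutative) rings with square-zero kernel. -/
theorem isUnit_of_map_of_ker_sq_zero (hr : Function.Surjective r)
    (hJ : ∀ x y, r x = 0 → r y = 0 → x * y = 0) {x : E} (hx : IsUnit (r x)) : IsUnit x := by
  obtain ⟨v, hv⟩ := hx
  obtain ⟨y, hy⟩ := hr (↑v⁻¹ : F)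
  have key : ∀ z : E, r z = 1 → z * (2 - z) = 1 ∧ (2 - z) * z = 1 := by
    intro z hz
    have h1 : r (z - 1) = 0 := by simp [hz]
    have h := hJ _ _ h1 h1
    constructor
    · rw [← sub_eq_zero, ← neg_eq_zero, ← h]; noncomm_ring
    · rw [← sub_eq_zero, ← neg_eq_zero, ← h]; noncomm_ring
  have h1 := (key (x * y) (by simp [hy, ← hv])).1
  have h2 := (key (y * x) (by simp [hy, ← hv])).2
  rw [mul_assoc] at h1
  rw [← mul_assoc] at h2
  have h3 := left_inv_eq_right_inv h2 h1
  exact ⟨⟨x, y * (2 - x * y), h1, h3 ▸ h2⟩, rfl⟩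

variable {G : Type*} [Group G] [Fintype G]

/-- A homomorphism from a finite group of invertible order to the multiplicative monoid of a ring
lifts along a surjection with square-zero kernel. -/
theorem exists_monoidHom_lift_of_ker_sq_zero (hr : Function.Surjective r)
    (hJ : ∀ x y, r x = 0 → r y = 0 → x * y = 0) (u : E) (hu : u * Fintype.card G = 1)
    (ρ : G →* F) : ∃ σ : G →* E, ∀ g, r (σ g) = ρ g := by
  have hu' : (Fintype.card G : E) * u = 1 := by rw [(Nat.cast_commute _ u).eq, hu]
  have hs : ∀ g, ∃ s : Eˣ, r s = ρ g := fun g => by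
    obtain ⟨x, hx⟩ := hr (ρ g)
    have : IsUnit x := isUnit_of_map_of_ker_sq_zero hr hJ
      (hx ▸ (Group.isUnit g).map ρ)
    exact ⟨this.unit, hx⟩
  choose s hs using hs
  have hsinv : ∀ g, r (↑(s g)⁻¹ : E) = ρ g⁻¹ := fun g => by
    refine left_inv_eq_right_inv (a := ρ g) ?_ ?_
    · rw [← hs, ← map_mul, Units.inv_mul, map_one]
    · rw [← map_mul, mul_inv_cancel, map_one]
  set a : G → G → E := fun h g => s (g * h) * ↑(s h)⁻¹ with ha
  have ha_mul : ∀ h g g', a (g' * h) g * a h g' = a h (g * g') := fun h g g' => by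
    simp only [ha, mul_assoc, Units.inv_mul_cancel_left]
  have hra : ∀ h g, r (a h g) = ρ g := fun h g => by
    simp only [ha, map_mul, hs, hsinv]
    rw [← map_mul, ← map_mul, mul_inv_cancel_right]
  set σ : G → E := fun g => u * ∑ h, a h g with hσ
  have hsum : ∀ g, ∑ h, a h g = Fintype.card G * σ g := fun g => by
    simp only [hσ, ← mul_assoc, hu', one_mul]
  have hrσ : ∀ g, r (σ g) = ρ g := fun g => by
    simp only [hσ, map_mul, map_sum, hra, Finset.sum_const, Finset.card_univ, nsmul_eq_mul]
    rw [← mul_assoc, ← map_natCast r, ← map_mul, hu, map_one, one_mul]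
  have hε : ∀ g h, r (a h g - σ g) = 0 := fun g h => by rw [map_sub, hra, hrσ, sub_self]
  have hε0 : ∀ g, ∑ h, (a h g - σ g) = 0 := fun g => by
    simp [Finset.sum_sub_distrib, hsum]
  refine ⟨⟨⟨σ, ?_⟩, ?_⟩, hrσ⟩
  · simp only [hσ, ha, one_mul, Units.mul_inv, Finset.sum_const, Finset.card_univ, nsmul_eq_mul,
      mul_one, hu]
  · intro g g'
    have h1 : ∀ h, a h (g * g') = σ g * σ g' + (a (g' * h) g - σ g) * σ g'
        + σ g * (a h g' - σ g') := fun h => by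
      rw [← ha_mul, ← sub_eq_zero, ← hJ _ _ (hε g (g' * h)) (hε g' h)]
      noncomm_ring
    have h2 : ∑ h, (a (g' * h) g - σ g) = 0 := by
      rw [← hε0 g]
      exact Fintype.sum_equiv (Equiv.mulLeft g') _ _ fun _ => rfl
    calc σ (g * g') = u * ∑ h, a h (g * g') := rfl
      _ = u * (Fintype.card G * (σ g * σ g')) := by
        simp only [h1, Finset.sum_add_distrib, ← Finset.sum_mul, ← Finset.mul_sum, h2, hε0,
          zero_mul, mul_zero, add_zero, mul_assoc, Finset.sum_const, Finset.card_univ, nsmul_eq_mul]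
      _ = σ g * σ g' := by rw [← mul_assoc, hu, one_mul]

end SquareZeroLifting

section Average

variable {A E F : Type*} [CommRing A] [Ring E] [Algebra A E] [Ring F]
variable {G : Type*} [Group G] [Fintype G]

/-- The average of `ρ' γ * x * (ρ γ)⁻¹` over the group, where `u` plays the role of `|G|⁻¹`. -/
def intertwinerAverage (u : A) (ρ ρ' : G →* E) : E →ₗ[A] E :=
  u • ∑ γ, LinearMap.mulLeft A (ρ' γ) ∘ₗ LinearMap.mulRight A (ρ γ⁻¹)

theorem intertwinerAverage_apply (u : A) (ρ ρ' : G →* E) (x : E) :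
    intertwinerAverage u ρ ρ' x = u • ∑ γ, ρ' γ * (x * ρ γ⁻¹) := by
  simp [intertwinerAverage, LinearMap.sum_apply]

theorem intertwinerAverage_mul (u : A) (ρ ρ' : G →* E) (x : E) (δ : G) :
    intertwinerAverage u ρ ρ' x * ρ δ = ρ' δ * intertwinerAverage u ρ ρ' x := by
  simp only [intertwinerAverage_apply, smul_mul_assoc, mul_smul_comm, Finset.sum_mul,
    Finset.mul_sum]
  congr 1
  refine Fintype.sum_equiv (Equiv.mulLeft δ⁻¹) _ _ fun γ => ?_
  simp only [Equiv.coe_mulLeft, mul_inv_rev, inv_inv, map_mul, ← mul_assoc]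
  rw [← map_mul ρ' δ, mul_inv_cancel, map_one, one_mul]

theorem map_intertwinerAverage {u : A} (hu : u * Fintype.card G = 1) (ρ ρ' : G →* E) (s : E →+* F)
    {x : E} (hx : ∀ γ, s x * s (ρ γ) = s (ρ' γ) * s x) :
    s (intertwinerAverage u ρ ρ' x) = s x := by
  have h : ∀ γ, s (ρ' γ * (x * ρ γ⁻¹)) = s x := fun γ => by
    rw [map_mul, map_mul, ← mul_assoc, ← hx, mul_assoc, ← map_mul, ← map_mul ρ, mul_inv_cancel,
      map_one, map_one, mul_one]
  rw [intertwinerAverage_apply, Algebra.smul_def, map_mul, map_sum]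
  simp only [h, Finset.sum_const, Finset.card_univ, nsmul_eq_mul]
  rw [← mul_assoc, ← map_natCast s, ← map_natCast (algebraMap A E), ← map_mul,
    ← map_mul (algebraMap A E),
    hu, map_one, map_one, one_mul]

end Average

/-- Deformation of `(φ, N, ρ)` along a square-zero surjection `r : E → F` whose kernel is `I • E`,
when the obstruction space computed in the quotient `K` of `F` vanishes. -/
theorem exists_lift_of_obstruction_eq_zero {A E F K : Type*} [CommRing A] [Ring E] [Algebra A E]
    [Ring F] [Ring K] {G : Type*} [Group G] [Fintype G] (θ : G ≃* G)
    {u : A} (hu : u * Fintype.card G = 1) (q : A) (I : Ideal A)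
    (r : E →+* F) (hr : Function.Surjective r) (t : F →+* K) (ht : Function.Surjective t)
    (hker : ∀ x, r x = 0 → x ∈ (I • ⊤ : Submodule A E))
    (hrI : ∀ a ∈ I, r (algebraMap A E a) = 0)
    (hIm : ∀ a ∈ I, ∀ x, t (r x) = 0 → a • x = 0)
    (ρ₀ : G →* F) (N₀ : F) (φ₀ : Fˣ) (hN₀ : IsNilpotent N₀)
    (hNρ : ∀ γ, N₀ * ρ₀ γ = ρ₀ γ * N₀)
    (hNφ : N₀ * φ₀ = r (algebraMap A E q) * (φ₀ * N₀))
    (hφρ : ∀ γ, φ₀ * ρ₀ γ = ρ₀ (θ γ) * φ₀)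
    (hH2 : ∀ h : K, (∀ γ, h * t (ρ₀ γ) = t (ρ₀ γ) * h) → ∃ f g : K,
      (∀ γ, f * t (ρ₀ γ) = t (ρ₀ γ) * f) ∧ (∀ γ, g * t (ρ₀ γ) = t (ρ₀ γ) * g) ∧
      h = (t N₀ * f - f * t N₀)
        + (t (r (algebraMap A E q)) * (t φ₀ * g * t (↑φ₀⁻¹ : F)) - g)) :
    ∃ (ρ : G →* E) (N : E) (φ : Eˣ), (∀ γ, r (ρ γ) = ρ₀ γ) ∧ r N = N₀ ∧ r φ = φ₀ ∧
      IsNilpotent N ∧ (∀ γ, N * ρ γ = ρ γ * N) ∧ N * φ = q • (φ * N) ∧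
      ∀ γ, φ * ρ γ = ρ (θ γ) * φ := by
  have hJ : ∀ x y, r x = 0 → r y = 0 → x * y = 0 := fun x y hx hy => by
    replace hx := hker x hx
    induction hx using Submodule.smul_induction_on' with
    | smul a ha z _ => rw [smul_mul_assoc, ← mul_smul_comm, hIm a ha y (by rw [hy, map_zero]),
        mul_zero]
    | add z _ w _ h1 h2 => rw [add_mul, h1, h2, add_zero]
  have hrI' : ∀ a ∈ I, ∀ x, r (a • x) = 0 := fun a ha x => by
    rw [Algebra.smul_def, map_mul, hrI a ha, zero_mul]
  obtain ⟨ρ, hρ⟩ := exists_monoidHom_lift_of_ker_sq_zero hr hJ (algebraMap A E u)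
    (by rw [← map_natCast (algebraMap A E), ← map_mul, hu, map_one]) ρ₀
  obtain ⟨N, hN, hNc⟩ : ∃ N, r N = N₀ ∧ ∀ γ, N * ρ γ = ρ γ * N := by
    obtain ⟨x, hx⟩ := hr N₀
    refine ⟨_, ?_, intertwinerAverage_mul u ρ ρ x⟩
    rw [map_intertwinerAverage hu _ _ _ fun γ => by rw [hx, hρ, hNρ], hx]
  obtain ⟨φ, hφ, hφc⟩ : ∃ φ : Eˣ, r φ = φ₀ ∧ ∀ γ, φ * ρ γ = ρ (θ γ) * φ := by
    obtain ⟨x, hx⟩ := hr φ₀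
    have h1 := map_intertwinerAverage hu ρ (ρ.comp ↑θ) r (x := x)
      fun γ => by simp only [MonoidHom.comp_apply, MonoidHom.coe_coe, hx, hρ, hφρ]
    rw [hx] at h1
    have h2 := isUnit_of_map_of_ker_sq_zero hr hJ (h1 ▸ φ₀.isUnit)
    exact ⟨h2.unit, h1, intertwinerAverage_mul u ρ (ρ.comp ↑θ) x⟩
  have hφi : r (↑φ⁻¹ : E) = (↑φ₀⁻¹ : F) := by
    refine left_inv_eq_right_inv (a := (φ₀ : F)) ?_ φ₀.mul_inv
    rw [← hφ, ← map_mul, Units.inv_mul, map_one]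
  have hφic : ∀ γ, (↑φ⁻¹ : E) * ρ (θ γ) = ρ γ * ↑φ⁻¹ := fun γ => by
    rw [Units.inv_mul_eq_iff_eq_mul, ← mul_assoc, hφc, mul_assoc, Units.mul_inv, mul_one]
  -- `P` is the intertwining average, a projection onto the commutant of `ρ`
  set P := intertwinerAverage u ρ ρ with hP
  have hPc : ∀ x γ, P x * ρ γ = ρ γ * P x := fun x γ => intertwinerAverage_mul u ρ ρ x γ
  have hPid : ∀ x, (∀ γ, x * ρ γ = ρ γ * x) → P x = x := fun x hx =>
    map_intertwinerAverage hu ρ ρ (RingHom.id E) hx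
  have decomp : ∀ x ∈ (I • ⊤ : Submodule A E), ∃ f g : E, r f = 0 ∧ r g = 0 ∧
      (∀ γ, f * ρ γ = ρ γ * f) ∧ (∀ γ, g * ρ γ = ρ γ * g) ∧
      P x = (N * f - f * N) + (q • (φ * g * ↑φ⁻¹) - g) := fun x hx => by
    induction hx using Submodule.smul_induction_on' with
    | smul a ha z _ =>
      obtain ⟨f, g, hf, hg, h⟩ := hH2 (t (r (P z))) fun γ => by
        rw [← hρ, ← map_mul, ← map_mul, hPc, map_mul, map_mul]
      have lift : ∀ y : K, (∀ γ, y * t (ρ₀ γ) = t (ρ₀ γ) * y) →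
          ∃ x, t (r x) = y ∧ ∀ γ, x * ρ γ = ρ γ * x := fun y hy => by
        obtain ⟨y', rfl⟩ := ht y
        obtain ⟨x, rfl⟩ := hr y'
        exact ⟨P x, map_intertwinerAverage hu ρ ρ (t.comp r)
          fun γ => by simpa only [RingHom.comp_apply, hρ] using hy γ, hPc x⟩
      obtain ⟨f, rfl, hfc⟩ := lift f hf
      obtain ⟨g, rfl, hgc⟩ := lift g hg
      refine ⟨a • f, a • g, hrI' a ha f, hrI' a ha g, fun γ => by
        rw [smul_mul_assoc, hfc, mul_smul_comm], fun γ => by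
        rw [smul_mul_assoc, hgc, mul_smul_comm], ?_⟩
      have h0 := hIm a ha (P z - ((N * f - f * N) + (q • (φ * g * ↑φ⁻¹) - g))) <| by
        simp only [Algebra.smul_def, map_sub, map_add, map_mul, hN, hφ, hφi, h, sub_self]
      rw [smul_sub, sub_eq_zero, ← map_smul] at h0
      rw [h0]
      simp only [smul_add, smul_sub, mul_smul_comm, smul_mul_assoc, smul_comm q a]
    | add z _ w _ h1 h2 =>
      obtain ⟨f, g, hf, hg, hfc, hgc, h⟩ := h1
      obtain ⟨f', g', hf', hg', hfc', hgc', h'⟩ := h2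
      refine ⟨f + f', g + g', by simp [hf, hf'], by simp [hg, hg'],
        fun γ => by rw [add_mul, mul_add, hfc, hfc'],
        fun γ => by rw [add_mul, mul_add, hgc, hgc'], ?_⟩
      rw [map_add, h, h']
      simp only [mul_add, add_mul, smul_add]
      abel
  set M : E := q • (φ * N * ↑φ⁻¹) with hM
  have hrM : r M = N₀ := by
    rw [hM, Algebra.smul_def, map_mul, map_mul, map_mul, hφ, hN, hφi, ← mul_assoc, ← hNφ,
      mul_assoc, Units.mul_inv, mul_one]
  have hMc : ∀ γ, M * ρ γ = ρ γ * M := fun δ => by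
    obtain ⟨γ, rfl⟩ := θ.surjective δ
    rw [hM, smul_mul_assoc, mul_smul_comm, mul_assoc, hφic, mul_assoc, ← mul_assoc N, hNc]
    simp only [← mul_assoc, hφc]
  obtain ⟨f, g, hf, hg, hfc, hgc, h⟩ := decomp (M - N) (hker _ (by rw [map_sub, hrM, hN, sub_self]))
  rw [hPid _ fun γ => by rw [sub_mul, mul_sub, hMc, hNc]] at h
  have hff := hJ f f hf hf
  let v : Eˣ := ⟨1 + f, 1 - f, by simp [mul_sub, add_mul, hff], by simp [mul_add, sub_mul, hff]⟩
  have hrN : r (N - g) = N₀ := by rw [map_sub, hN, hg, sub_zero]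
  refine ⟨ρ, N - g, v * φ, hρ, hrN, ?_, ?_, ?_, ?_, ?_⟩
  · simp [v, hf, hφ]
  · obtain ⟨k, hk⟩ := hN₀
    refine ⟨k + k, ?_⟩
    rw [pow_add]
    exact hJ _ _ (by rw [map_pow, hrN, hk]) (by rw [map_pow, hrN, hk])
  · exact fun γ => by rw [sub_mul, mul_sub, hNc, hgc]
  · set X : E := q • (φ * g * ↑φ⁻¹) with hX
    have hrX : r X = 0 := by rw [hX, Algebra.smul_def]; simp [hg]
    have h1 : q • (φ * (N - g)) = (M - X) * φ := by
      rw [hM, hX, ← smul_sub, smul_mul_assoc, ← sub_mul, ← mul_sub, Units.inv_mul_cancel_right]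
    have h2 : f * (M - N) = 0 := hJ _ _ hf (by rw [map_sub, hrM, hN, sub_self])
    have h3 : f * X = 0 := hJ _ _ hf hrX
    have h4 : g * f = 0 := hJ _ _ hg hf
    rw [Units.val_mul, mul_assoc, ← mul_smul_comm, h1, ← mul_assoc, ← mul_assoc]
    congr 1
    rw [mul_sub, sub_eq_zero] at h2
    rw [sub_eq_iff_eq_add] at h
    simp only [v, sub_mul, mul_sub, mul_add, add_mul, mul_one, one_mul, h2, h3, h4]
    rw [h]
    abel
  · intro γ
    simp only [Units.val_mul, v, mul_assoc, hφc]
    simp only [← mul_assoc, add_mul, mul_add, one_mul, hfc]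

section InducedEndomorphism

variable {R S M M' : Type*} [CommRing R] [CommRing S] [AddCommGroup M] [AddCommGroup M']
  [Module R M] [Module S M'] {σ : R →+* S} {J : Ideal R} {π : M →ₛₗ[σ] M'}

theorem map_end_eq_of_map_eq (hJ : ∀ m, π m = 0 ↔ m ∈ (J • ⊤ : Submodule R M))
    (x : Module.End R M) {m n : M} (h : π m = π n) : π (x m) = π (x n) := by
  rw [← sub_eq_zero, ← map_sub, ← map_sub, hJ]
  rw [← sub_eq_zero, ← map_sub, hJ] at h
  have h1 : x (m - n) ∈ Submodule.map x (J • ⊤) := Submodule.mem_map_of_mem h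
  rw [Submodule.map_smul''] at h1
  exact Submodule.smul_mono le_rfl le_top h1

/-- The ring homomorphism between endomorphism rings induced by a semilinear surjection whose
kernel is `J • ⊤`. -/
noncomputable def inducedEnd (hσ : Function.Surjective σ) (hπ : Function.Surjective π)
    (hJ : ∀ m, π m = 0 ↔ m ∈ (J • ⊤ : Submodule R M)) : Module.End R M →+* Module.End S M' where
  toFun x :=
    { toFun := fun y => π (x (Function.surjInv hπ y))
      map_add' := fun y z => by
        rw [← map_add, ← map_add]
        exact map_end_eq_of_map_eq hJ x (by simp [Function.surjInv_eq hπ])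
      map_smul' := fun c y => by
        obtain ⟨c, rfl⟩ := hσ c
        rw [RingHom.id_apply, ← map_smulₛₗ, ← map_smul]
        exact map_end_eq_of_map_eq hJ x (by simp [Function.surjInv_eq hπ]) }
  map_one' := by ext y; simp [Function.surjInv_eq hπ]
  map_mul' x y := by
    ext z
    exact map_end_eq_of_map_eq hJ x (by simp [Function.surjInv_eq hπ])
  map_zero' := by ext y; simp
  map_add' x y := by ext z; simp

theorem inducedEnd_apply (hσ : Function.Surjective σ) (hπ : Function.Surjective π)
    (hJ : ∀ m, π m = 0 ↔ m ∈ (J • ⊤ : Submodule R M)) (x : Module.End R M) (m : M) :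
    inducedEnd hσ hπ hJ x (π m) = π (x m) :=
  map_end_eq_of_map_eq hJ x (Function.surjInv_eq hπ _)

theorem inducedEnd_eq_iff (hσ : Function.Surjective σ) (hπ : Function.Surjective π)
    (hJ : ∀ m, π m = 0 ↔ m ∈ (J • ⊤ : Submodule R M)) {x : Module.End R M}
    {y : Module.End S M'} : inducedEnd hσ hπ hJ x = y ↔ ∀ m, π (x m) = y (π m) := by
  refine ⟨fun h m => by rw [← h, inducedEnd_apply], fun h => LinearMap.ext fun z => ?_⟩
  obtain ⟨m, rfl⟩ := hπ z
  rw [inducedEnd_apply, h]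

theorem inducedEnd_algebraMap (hσ : Function.Surjective σ) (hπ : Function.Surjective π)
    (hJ : ∀ m, π m = 0 ↔ m ∈ (J • ⊤ : Submodule R M)) (a : R) :
    inducedEnd hσ hπ hJ (algebraMap R _ a) = algebraMap S _ (σ a) :=
  (inducedEnd_eq_iff hσ hπ hJ).2 fun m => by simp [Module.algebraMap_end_apply]

theorem inducedEnd_surjective [Module.Free R M] (hσ : Function.Surjective σ)
    (hπ : Function.Surjective π) (hJ : ∀ m, π m = 0 ↔ m ∈ (J • ⊤ : Submodule R M)) :
    Function.Surjective (inducedEnd hσ hπ hJ) := fun y => by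
  let b := Module.Free.chooseBasis R M
  refine ⟨b.constr R fun i => Function.surjInv hπ (y (π (b i))),
    (inducedEnd_eq_iff hσ hπ hJ).2 fun m => ?_⟩
  have h : π.comp (b.constr R fun i => Function.surjInv hπ (y (π (b i)))) = y.comp π :=
    b.ext fun i => by simp [Function.surjInv_eq hπ]
  exact LinearMap.congr_fun h m

end InducedEndomorphism

theorem Module.Basis.mem_ideal_smul_top_iff {ι R M : Type*} [CommRing R] [AddCommGroup M]
    [Module R M] [Fintype ι] (b : Module.Basis ι R M) (J : Ideal R) (m : M) :
    m ∈ (J • ⊤ : Submodule R M) ↔ ∀ i, b.repr m i ∈ J := by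
  refine ⟨fun h i => ?_, fun h => ?_⟩
  · induction h using Submodule.smul_induction_on' with
    | smul a ha z _ => simpa using J.mul_mem_right _ ha
    | add z _ w _ h1 h2 => simpa using J.add_mem h1 h2
  · rw [← b.sum_repr m]
    exact Submodule.sum_mem _ fun i _ => Submodule.smul_mem_smul (h i) trivial

theorem Module.End.mem_ideal_smul_top_of_forall {ι R : Type*} [CommRing R] [Fintype ι]
    [DecidableEq ι] (J : Ideal R) (x : Module.End R (ι → R)) (hx : ∀ d i, x d i ∈ J) :
    x ∈ (J • ⊤ : Submodule R (Module.End R (ι → R))) := by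
  have h : x = ∑ i, ∑ j, x (Pi.single j 1) i • (Pi.basisFun R ι).end (i, j) := by
    refine (Pi.basisFun R ι).ext fun k => funext fun i => ?_
    simp only [LinearMap.sum_apply, LinearMap.smul_apply, Module.Basis.end_apply_apply]
    simp [Finset.sum_apply, Pi.single_apply]
  rw [h]
  exact Submodule.sum_mem _ fun i _ => Submodule.sum_mem _ fun j _ =>
    Submodule.smul_mem_smul (hx _ i) trivial

/-- Coordinatewise reduction `A ^ n → M` attached to a basis of an `A ⧸ I`-module `M`. -/
noncomputable def Module.Basis.quotientReduction {ι A M : Type*} [CommRing A] {I : Ideal A}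
    [AddCommGroup M] [Module (A ⧸ I) M] [Fintype ι] (b : Module.Basis ι (A ⧸ I) M) :
    (ι → A) →ₛₗ[Ideal.Quotient.mk I] M where
  toFun d := b.equivFun.symm fun i => Ideal.Quotient.mk I (d i)
  map_add' d e := by rw [← map_add]; rfl
  map_smul' a d := by rw [← map_smul]; congr 1

theorem Module.Basis.repr_quotientReduction {ι A M : Type*} [CommRing A] {I : Ideal A}
    [AddCommGroup M] [Module (A ⧸ I) M] [Fintype ι] (b : Module.Basis ι (A ⧸ I) M)
    (d : ι → A) (i : ι) : b.repr (b.quotientReduction d) i = Ideal.Quotient.mk I (d i) := by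
  rw [← b.equivFun_apply]
  simp only [quotientReduction, LinearMap.coe_mk, AddHom.coe_mk, LinearEquiv.apply_symm_apply]

theorem Module.Basis.quotientReduction_surjective {ι A M : Type*} [CommRing A] {I : Ideal A}
    [AddCommGroup M] [Module (A ⧸ I) M] [Fintype ι] (b : Module.Basis ι (A ⧸ I) M) :
    Function.Surjective b.quotientReduction := fun m => by
  choose d hd using fun i => Ideal.Quotient.mk_surjective (b.repr m i)
  exact ⟨d, b.repr.injective <| Finsupp.ext fun i => by rw [b.repr_quotientReduction, hd]⟩

theorem Module.Basis.quotientReduction_eq_zero_iff {ι A M : Type*} [CommRing A] {I : Ideal A}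
    [AddCommGroup M] [Module (A ⧸ I) M] [Fintype ι] (b : Module.Basis ι (A ⧸ I) M)
    (d : ι → A) : b.quotientReduction d = 0 ↔ d ∈ (I • ⊤ : Submodule A (ι → A)) := by
  rw [(Pi.basisFun A ι).mem_ideal_smul_top_iff, ← b.repr.map_eq_zero_iff, Finsupp.ext_iff]
  simp [b.repr_quotientReduction, Ideal.Quotient.eq_zero_iff_mem]

/-- The zero module. -/
def PhiNGModule.zero (R : Type) [CommRing R] (q : R) (G : Type) [Group G] (θ : G ≃* G) :
    PhiNGModule R q G θ where
  D := PUnit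
  ρ := 1
  N := 0
  nilpotent_N := IsNilpotent.zero
  comm_N_ρ _ := rfl
  φ := LinearEquiv.refl R _
  rel_N_φ := rfl
  rel_φ_ρ _ := rfl

/-- The `(φ,N,G)`-module given by elements of the endomorphism ring of a finite free module. -/
def PhiNGModule.ofEnd {R : Type} [CommRing R] (q : R) {G : Type} [Group G]
    (θ : G ≃* G) (D : Type) [AddCommGroup D] [Module R D] [Module.Free R D] [Module.Finite R D]
    (ρ : G →* Module.End R D) (N : Module.End R D) (φ : (Module.End R D)ˣ) (hN : IsNilpotent N)
    (hNρ : ∀ γ, N * ρ γ = ρ γ * N) (hNφ : N * φ = q • (φ * N))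
    (hφρ : ∀ γ, φ * ρ γ = ρ (θ γ) * φ) : PhiNGModule R q G θ where
  D := D
  ρ := (LinearMap.GeneralLinearGroup.generalLinearEquiv R D).toMonoidHom.comp ρ.toHomUnits
  N := N
  nilpotent_N := hN
  comm_N_ρ := hNρ
  φ := LinearMap.GeneralLinearGroup.generalLinearEquiv R D φ
  rel_N_φ := hNφ
  rel_φ_ρ γ := by
    change φ.1 * (ρ γ * (↑φ⁻¹ : Module.End R D)) = ρ (θ γ)
    rw [← mul_assoc, hφρ, mul_assoc, Units.mul_inv, mul_one]

/-- **Unobstructed deformation of `(φ,N,G)`-modules when `H²` vanishes.**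
Fix distinct primes `l ≠ p`, `f ≥ 1`, and set `q = l^f ∈ ℚ_p`.  Let `A` be a commutative local
`ℚ_p`-algebra with maximal ideal `m_A`, residue field `k = A/m_A`, and let `I ⊆ A` be an ideal
with `I·m_A = 0`.  Let `D_{A/I}` be a `(φ,N,G)`-module over `A/I` and let `D_k` be its
reduction modulo the maximal ideal (encoded by the semilinear surjection `πk` with kernel
`m̄·D_{A/I}`, commuting with `ρ`, `N`, `φ`).  If `H²(D_k) = 0` — i.e. every `G`-equivariant
`k`-linear endomorphism `h` of `D_k` is of the form
`h = (N∘f − f∘N) + (q·φ∘g∘φ⁻¹ − g)` with `f`, `g` `G`-equivariant — then there is a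
`(φ,N,G)`-module `D_A` over `A` whose reduction modulo `I` is isomorphic to `D_{A/I}`
(encoded by the semilinear surjection `red` with kernel `I·D_A`, commuting with `ρ`, `N`, `φ`). -/
theorem statement0
    (p l f : ℕ) [Fact p.Prime] (hl : l.Prime) (hlp : l ≠ p) (hf : 1 ≤ f)
    (G : Type) [Group G] [Finite G] (θ : G ≃* G)
    (A : Type) [CommRing A] [Algebra ℚ_[p] A] [IsLocalRing A]
    (I : Ideal A) (hI : I * IsLocalRing.maximalIdeal A = ⊥)
    (Dbar : PhiNGModule (A ⧸ I) (algebraMap ℚ_[p] (A ⧸ I) ((l : ℚ_[p]) ^ f)) G θ)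
    (Dk : PhiNGModule (IsLocalRing.ResidueField A)
      (algebraMap ℚ_[p] (IsLocalRing.ResidueField A) ((l : ℚ_[p]) ^ f)) G θ)
    (πk : Dbar.D →+ Dk.D)
    (hπk_smul : ∀ (a : A) (x : Dbar.D),
      πk (Ideal.Quotient.mk I a • x) = IsLocalRing.residue A a • πk x)
    (hπk_surj : Function.Surjective πk)
    (hπk_ker : ∀ x : Dbar.D, πk x = 0 ↔
      x ∈ ((IsLocalRing.maximalIdeal A).map (Ideal.Quotient.mk I) • ⊤ : Submodule (A ⧸ I) Dbar.D))
    (hπk_N : ∀ x, πk (Dbar.N x) = Dk.N (πk x))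
    (hπk_ρ : ∀ (γ : G) (x), πk (Dbar.ρ γ x) = Dk.ρ γ (πk x))
    (hπk_φ : ∀ x, πk (Dbar.φ x) = Dk.φ (πk x))
    (hH2 : ∀ h : Dk.D →ₗ[IsLocalRing.ResidueField A] Dk.D,
      (∀ γ : G, h ∘ₗ ((Dk.ρ γ : Dk.D ≃ₗ[IsLocalRing.ResidueField A] Dk.D) : Dk.D →ₗ[IsLocalRing.ResidueField A] Dk.D)
          = ((Dk.ρ γ : Dk.D ≃ₗ[IsLocalRing.ResidueField A] Dk.D) : Dk.D →ₗ[IsLocalRing.ResidueField A] Dk.D) ∘ₗ h) →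
      ∃ (f' g : Dk.D →ₗ[IsLocalRing.ResidueField A] Dk.D),
        (∀ γ : G, f' ∘ₗ ((Dk.ρ γ : Dk.D ≃ₗ[IsLocalRing.ResidueField A] Dk.D) : Dk.D →ₗ[IsLocalRing.ResidueField A] Dk.D)
            = ((Dk.ρ γ : Dk.D ≃ₗ[IsLocalRing.ResidueField A] Dk.D) : Dk.D →ₗ[IsLocalRing.ResidueField A] Dk.D) ∘ₗ f') ∧
        (∀ γ : G, g ∘ₗ ((Dk.ρ γ : Dk.D ≃ₗ[IsLocalRing.ResidueField A] Dk.D) : Dk.D →ₗ[IsLocalRing.ResidueField A] Dk.D)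
            = ((Dk.ρ γ : Dk.D ≃ₗ[IsLocalRing.ResidueField A] Dk.D) : Dk.D →ₗ[IsLocalRing.ResidueField A] Dk.D) ∘ₗ g) ∧
        h = (Dk.N ∘ₗ f' - f' ∘ₗ Dk.N)
            + (algebraMap ℚ_[p] (IsLocalRing.ResidueField A) ((l : ℚ_[p]) ^ f)
                • ((Dk.φ : Dk.D →ₗ[IsLocalRing.ResidueField A] Dk.D) ∘ₗ g
                    ∘ₗ (Dk.φ.symm : Dk.D →ₗ[IsLocalRing.ResidueField A] Dk.D)) - g)) :
    ∃ (DA : PhiNGModule A (algebraMap ℚ_[p] A ((l : ℚ_[p]) ^ f)) G θ) (red : DA.D →+ Dbar.D),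
      Function.Surjective red ∧
      (∀ (a : A) (x : DA.D), red (a • x) = Ideal.Quotient.mk I a • red x) ∧
      (∀ x : DA.D, red x = 0 ↔ x ∈ (I • ⊤ : Submodule A DA.D)) ∧
      (∀ x, red (DA.N x) = Dbar.N (red x)) ∧
      (∀ (γ : G) (x), red (DA.ρ γ x) = Dbar.ρ γ (red x)) ∧
      (∀ x, red (DA.φ x) = Dbar.φ (red x)) := by
 
  let m := IsLocalRing.maximalIdeal A
  by_cases hItop : I = ⊤
  · have : Subsingleton (A ⧸ I) := Ideal.Quotient.subsingleton_iff.2 hItop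
    have : Subsingleton Dbar.D := Module.subsingleton (A ⧸ I) Dbar.D
    have : Subsingleton (PhiNGModule.zero A (algebraMap ℚ_[p] A ((l : ℚ_[p]) ^ f)) G θ).D :=
      inferInstanceAs (Subsingleton PUnit)
    refine ⟨PhiNGModule.zero A _ G θ, 0, fun x => ⟨0, Subsingleton.elim _ _⟩, ?_, fun x => ?_,
      ?_, ?_, ?_⟩
    · exact fun _ _ => Subsingleton.elim _ _
    · rw [Subsingleton.elim x 0]; simp
    all_goals intros; exact Subsingleton.elim _ _
  have hIm : I ≤ m := IsLocalRing.le_maximalIdeal hItop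
  have := Fintype.ofFinite G
  -- the three modules and the maps between them
  let b := Module.Free.chooseBasis (A ⧸ I) Dbar.D
  let ι := Module.Free.ChooseBasisIndex (A ⧸ I) Dbar.D
  let σ : A ⧸ I →+* IsLocalRing.ResidueField A := Ideal.Quotient.factor hIm
  have hσ : Function.Surjective σ := Ideal.Quotient.factor_surjective hIm
  let π : Dbar.D →ₛₗ[σ] Dk.D :=
    { πk with
      map_smul' := fun c x => by
        obtain ⟨a, rfl⟩ := Ideal.Quotient.mk_surjective c
        exact hπk_smul a x }
  have hπ : Function.Surjective π := hπk_surj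
  have hmk : Function.Surjective (Ideal.Quotient.mk I) := Ideal.Quotient.mk_surjective
  let r := inducedEnd hmk b.quotientReduction_surjective b.quotientReduction_eq_zero_iff
  let t := inducedEnd hσ hπ hπk_ker
  have hr_iff : ∀ {x y}, r x = y ↔ ∀ d, b.quotientReduction (x d) = y (b.quotientReduction d) :=
    inducedEnd_eq_iff _ _ _
  have ht_iff : ∀ {x y}, t x = y ↔ ∀ d, π (x d) = y (π d) := inducedEnd_eq_iff _ _ _
  have hker : ∀ x, r x = 0 → x ∈ (I • ⊤ : Submodule A (Module.End A (ι → A))) := fun x hx =>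
    Module.End.mem_ideal_smul_top_of_forall I x fun d i => by
      have h := (b.quotientReduction_eq_zero_iff _).1 (hr_iff.1 hx d)
      simpa using ((Pi.basisFun A ι).mem_ideal_smul_top_iff _ _).1 h i
  have hrA : ∀ a, r (algebraMap A _ a) = algebraMap (A ⧸ I) _ (Ideal.Quotient.mk I a) :=
    inducedEnd_algebraMap _ _ _
  have htA : ∀ a, t (algebraMap (A ⧸ I) _ a) = algebraMap _ _ (σ a) :=
    inducedEnd_algebraMap _ _ _
  have hIm0 : ∀ a ∈ I, ∀ x, t (r x) = 0 → a • x = 0 := fun a ha x hx => by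
    refine LinearMap.ext fun d => funext fun i => ?_
    have h1 := ht_iff.1 hx (b.quotientReduction d)
    rw [hr_iff.1 rfl d |>.symm] at h1
    have h2 := (b.mem_ideal_smul_top_iff _ _).1 ((hπk_ker _).1 h1) i
    rw [b.repr_quotientReduction, Ideal.mem_quotient_iff_mem hIm] at h2
    have h3 := Ideal.mul_mem_mul ha h2
    rw [hI] at h3
    exact h3
  have hu : ∃ u : A, u * Fintype.card G = 1 := by
    refine ⟨algebraMap ℚ_[p] A (Fintype.card G : ℚ_[p])⁻¹, ?_⟩
    rw [← map_natCast (algebraMap ℚ_[p] A), ← map_mul, inv_mul_cancel₀, map_one]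
    exact_mod_cast Fintype.card_ne_zero
  obtain ⟨u, hu⟩ := hu
  let ρ₀ : G →* Module.End (A ⧸ I) Dbar.D :=
    (LinearEquiv.automorphismGroup.toLinearMapMonoidHom).comp Dbar.ρ
  let φ₀ : (Module.End (A ⧸ I) Dbar.D)ˣ :=
    (LinearMap.GeneralLinearGroup.generalLinearEquiv _ _).symm Dbar.φ
  have htρ : ∀ γ, t (ρ₀ γ) = (Dk.ρ γ : Dk.D →ₗ[_] Dk.D) := fun γ => ht_iff.2 (hπk_ρ γ)
  have htN : t Dbar.N = Dk.N := ht_iff.2 hπk_N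
  have htφ : t φ₀.1 = (Dk.φ : Dk.D →ₗ[_] Dk.D) := ht_iff.2 hπk_φ
  have htφi : t (↑φ₀⁻¹ : Module.End (A ⧸ I) Dbar.D) = (Dk.φ.symm : Dk.D →ₗ[_] Dk.D) :=
    ht_iff.2 fun d => by
      refine (Dk.φ.symm_apply_eq.2 ?_).symm
      have h := hπk_φ (Dbar.φ.symm d)
      rw [Dbar.φ.apply_symm_apply] at h
      exact h
  have hq : r (algebraMap A _ (algebraMap ℚ_[p] A ((l : ℚ_[p]) ^ f))) =
      algebraMap (A ⧸ I) _ (algebraMap ℚ_[p] (A ⧸ I) ((l : ℚ_[p]) ^ f)) := hrA _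
  have htq : t (algebraMap (A ⧸ I) _ (algebraMap ℚ_[p] (A ⧸ I) ((l : ℚ_[p]) ^ f))) =
      algebraMap _ _ (algebraMap ℚ_[p] (IsLocalRing.ResidueField A) ((l : ℚ_[p]) ^ f)) := htA _
  obtain ⟨ρ, N, φ, hρ, hN, hφ, hnil, hNρ, hNφ, hφρ⟩ :=
    exists_lift_of_obstruction_eq_zero θ hu (algebraMap ℚ_[p] A ((l : ℚ_[p]) ^ f)) I r
      (inducedEnd_surjective _ _ _) t (inducedEnd_surjective _ _ _) hker
      (fun a ha => by rw [hrA, Ideal.Quotient.eq_zero_iff_mem.2 ha, map_zero]) hIm0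
      ρ₀ Dbar.N φ₀ Dbar.nilpotent_N Dbar.comm_N_ρ
      (by rw [hq, ← Algebra.smul_def]; exact Dbar.rel_N_φ)
      (fun γ => by
        have h : φ₀.1 * (ρ₀ γ * (↑φ₀⁻¹ : Module.End (A ⧸ I) Dbar.D)) = ρ₀ (θ γ) := Dbar.rel_φ_ρ γ
        rw [← h, mul_assoc, mul_assoc, Units.inv_mul, mul_one])
      (fun h hh => by
        simp only [htρ] at hh ⊢
        obtain ⟨f', g, hf', hg, H⟩ := hH2 h hh
        refine ⟨f', g, hf', hg, ?_⟩
        rw [hq, htq, htN, htφ, htφi, ← Algebra.smul_def, mul_assoc]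
        exact H)
  exact ⟨PhiNGModule.ofEnd _ θ (ι → A) ρ N φ hnil hNρ hNφ hφρ,
    b.quotientReduction.toAddMonoidHom, b.quotientReduction_surjective,
    b.quotientReduction.map_smulₛₗ, b.quotientReduction_eq_zero_iff, hr_iff.1 hN,
    fun γ => hr_iff.1 (hρ γ), hr_iff.1 hφ⟩
end

section
/- Let p be a prime. Let L be a finite free 𝒪-module with an 𝒪-linear action of GL₂(F_p) such that the Q̄_p-representation V = L ⊗_𝒪 Q̄_p is irreducible. Suppose V ≅ sp ⊗ (χ ∘ det), where χ: F_p^× → Q̄_p^× is the character χ(a) = ã^m for some m ∈ ℤ/(p−1)ℤ. Then L ⊗_𝒪 F̄_p ≅ σ_{m,p−1} as F̄_p-representations of GL₂(F_p). -/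
variable (p : ℕ) [Fact p.Prime]

noncomputable instance : Fintype (Projectivization (ZMod p) (Fin 2 → ZMod p)) := by
  have h : Finite (Projectivization (ZMod p) (Fin 2 → ZMod p)) := Quotient.finite _
  exact Fintype.ofFinite _

/-- The action of `g ∈ GL₂(F_p)` on the projective line `P¹(F_p)`. -/
noncomputable def projAct (g : GL (Fin 2) (ZMod p)) :
    Projectivization (ZMod p) (Fin 2 → ZMod p) → Projectivization (ZMod p) (Fin 2 → ZMod p) :=
  Projectivization.map
    ((LinearMap.GeneralLinearGroup.generalLinearEquiv (ZMod p) (Fin 2 → ZMod p)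
      (Matrix.GeneralLinearGroup.toLin g)) : (Fin 2 → ZMod p) →ₗ[ZMod p] (Fin 2 → ZMod p))
    (LinearMap.GeneralLinearGroup.generalLinearEquiv (ZMod p) (Fin 2 → ZMod p)
      (Matrix.GeneralLinearGroup.toLin g)).injective

/-- The underlying space of the representation `sp` of `GL₂(F_p)`: functions
`P¹(F_p) → K` whose values sum to zero. -/
noncomputable def spSub (K : Type) [Field K] :
    Submodule K (Projectivization (ZMod p) (Fin 2 → ZMod p) → K) :=
  LinearMap.ker (∑ x : Projectivization (ZMod p) (Fin 2 → ZMod p), LinearMap.proj x)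

open MvPolynomial in
/-- The substitution action of a matrix `(a b; c d)` over `F_p` on polynomials over `𝕜`
(`𝕜` of characteristic `p`, via `ι : F_p → 𝕜`): `F(X,Y) ↦ F(aX+cY, bX+dY)`. -/
noncomputable def glSubstAct (𝕜 : Type) [CommRing 𝕜] (ι : ZMod p →+* 𝕜)
    (m : Matrix (Fin 2) (Fin 2) (ZMod p)) :
    MvPolynomial (Fin 2) 𝕜 →ₐ[𝕜] MvPolynomial (Fin 2) 𝕜 :=
  aeval ![C (ι (m 0 0)) * X 0 + C (ι (m 1 0)) * X 1,
    C (ι (m 0 1)) * X 0 + C (ι (m 1 1)) * X 1]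

theorem projMk_eq_iff {v w : Fin 2 → ZMod p} (hv : v ≠ 0) (hw : w ≠ 0) :
    Projectivization.mk (ZMod p) v hv = Projectivization.mk (ZMod p) w hw ↔
      v 0 * w 1 = v 1 * w 0 := by
  rw [Projectivization.mk_eq_mk_iff']
  constructor
  · rintro ⟨a, rfl⟩
    simp only [Pi.smul_apply, smul_eq_mul]
    ring
  · intro h
    by_cases h0 : w 0 = 0
    · have h1 : w 1 ≠ 0 := fun h1 => hw (by ext i; fin_cases i <;> simp [h0, h1])
      refine ⟨v 1 / w 1, ?_⟩
      have hv0 : v 0 = 0 := by simpa [h0, h1] using h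
      ext i
      fin_cases i <;> simp [h0, h1, hv0]
    · refine ⟨v 0 / w 0, ?_⟩
      ext i
      fin_cases i
      · simp [h0]
      · simp only [Pi.smul_apply, smul_eq_mul, Fin.mk_one]
        rw [div_mul_eq_mul_div, h, mul_div_assoc, div_self h0, mul_one]

theorem mulVec_ne_zero (g : GL (Fin 2) (ZMod p)) {v : Fin 2 → ZMod p} (hv : v ≠ 0) :
    (g : Matrix (Fin 2) (Fin 2) (ZMod p)).mulVec v ≠ 0 := by
  intro h
  apply hv
  have := congrArg ((g⁻¹ : GL (Fin 2) (ZMod p)) : Matrix (Fin 2) (Fin 2) (ZMod p)).mulVec h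
  rwa [Matrix.mulVec_mulVec, ← Units.val_mul, inv_mul_cancel, Units.val_one, Matrix.one_mulVec,
    Matrix.mulVec_zero] at this

theorem projAct_mk (g : GL (Fin 2) (ZMod p)) {v : Fin 2 → ZMod p} (hv : v ≠ 0) :
    projAct p g (Projectivization.mk (ZMod p) v hv) =
      Projectivization.mk (ZMod p) ((g : Matrix (Fin 2) (Fin 2) (ZMod p)).mulVec v)
        (mulVec_ne_zero p g hv) := rfl

theorem projAct_mul (g h : GL (Fin 2) (ZMod p))
    (x : Projectivization (ZMod p) (Fin 2 → ZMod p)) :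
    projAct p (g * h) x = projAct p g (projAct p h x) := by
  induction x using Projectivization.ind with
  | h v hv =>
    simp only [projAct_mk, Units.val_mul, Matrix.mulVec_mulVec]

theorem projAct_one (x : Projectivization (ZMod p) (Fin 2 → ZMod p)) :
    projAct p 1 x = x := by
  induction x using Projectivization.ind with
  | h v hv =>
    simp only [projAct_mk, Units.val_one, Matrix.one_mulVec]

/-- The permutation of `P¹(F_p)` given by `g`. -/
noncomputable def projPerm (g : GL (Fin 2) (ZMod p)) :
    Equiv.Perm (Projectivization (ZMod p) (Fin 2 → ZMod p)) where
  toFun := projAct p g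
  invFun := projAct p g⁻¹
  left_inv x := by rw [← projAct_mul, inv_mul_cancel, projAct_one]
  right_inv x := by rw [← projAct_mul, mul_inv_cancel, projAct_one]

/-- The transvection `w ↦ w + t (w₀ v₁ - w₁ v₀) v` fixing the line through `v`. -/
noncomputable def transv (v : Fin 2 → ZMod p) (t : ZMod p) : GL (Fin 2) (ZMod p) :=
  Matrix.GeneralLinearGroup.mkOfDetNeZero
    !![1 + t * v 0 * v 1, -(t * v 0 * v 0); t * v 1 * v 1, 1 - t * v 0 * v 1] (by
      rw [Matrix.det_fin_two_of]
      ring_nf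
      exact one_ne_zero)

theorem coe_transv (v : Fin 2 → ZMod p) (t : ZMod p) :
    (transv p v t : Matrix (Fin 2) (Fin 2) (ZMod p)) =
      !![1 + t * v 0 * v 1, -(t * v 0 * v 0); t * v 1 * v 1, 1 - t * v 0 * v 1] := rfl

theorem det_transv (v : Fin 2 → ZMod p) (t : ZMod p) :
    Matrix.GeneralLinearGroup.det (transv p v t) = 1 := by
  ext
  rw [Matrix.GeneralLinearGroup.val_det_apply, coe_transv, Matrix.det_fin_two_of, Units.val_one]
  ring

theorem transv_mulVec (v w : Fin 2 → ZMod p) (t : ZMod p) :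
    (transv p v t : Matrix (Fin 2) (Fin 2) (ZMod p)).mulVec w =
      w + (t * (w 0 * v 1 - w 1 * v 0)) • v := by
  ext i
  fin_cases i <;>
    simp [coe_transv, Matrix.mulVec, dotProduct, Fin.sum_univ_two] <;> ring

theorem card_proj : Fintype.card (Projectivization (ZMod p) (Fin 2 → ZMod p)) = p + 1 := by
  rw [← Nat.card_eq_fintype_card, Projectivization.card_of_finrank_two, Nat.card_zmod]
  simp

open Classical in
theorem sum_projAct_transv {k : Type} [Field k] [CharP k p] (v : Fin 2 → ZMod p) (hv : v ≠ 0)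
    (f : Projectivization (ZMod p) (Fin 2 → ZMod p) → k) (hf : ∑ x, f x = 0)
    (y : Projectivization (ZMod p) (Fin 2 → ZMod p)) :
    ∑ t, f (projAct p (transv p v t) y) =
      f (Projectivization.mk (ZMod p) v hv) *
        (if y = Projectivization.mk (ZMod p) v hv then 0 else -1) := by
  induction y using Projectivization.ind with
  | h w hw =>
  split_ifs with hy
  · rw [projMk_eq_iff] at hy
    have : ∀ t, projAct p (transv p v t) (Projectivization.mk (ZMod p) w hw) =
        Projectivization.mk (ZMod p) v hv := fun t => by
      rw [projAct_mk, projMk_eq_iff, transv_mulVec]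
      simp only [Pi.add_apply, Pi.smul_apply, smul_eq_mul]
      linear_combination hy
    simp [this, ZMod.card]
  · have hc : w 0 * v 1 - w 1 * v 0 ≠ 0 := fun h => hy ((projMk_eq_iff p hw hv).2 (sub_eq_zero.1 h))
    have hinj : Function.Injective
        fun t => projAct p (transv p v t) (Projectivization.mk (ZMod p) w hw) := by
      intro t s hts
      simp only [projAct_mk, projMk_eq_iff, transv_mulVec, Pi.add_apply, Pi.smul_apply,
        smul_eq_mul] at hts
      have : (t - s) * (w 0 * v 1 - w 1 * v 0) ^ 2 = 0 := by linear_combination -hts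
      simpa [hc, sub_eq_zero] using this
    have himg : Finset.univ.image
        (fun t => projAct p (transv p v t) (Projectivization.mk (ZMod p) w hw)) =
        Finset.univ.erase (Projectivization.mk (ZMod p) v hv) := by
      apply Finset.eq_of_subset_of_card_le
      · intro z hz
        obtain ⟨t, -, rfl⟩ := Finset.mem_image.1 hz
        refine Finset.mem_erase.2 ⟨fun h => hc ?_, Finset.mem_univ _⟩
        rw [projAct_mk, projMk_eq_iff, transv_mulVec] at h
        simp only [Pi.add_apply, Pi.smul_apply, smul_eq_mul] at h
        linear_combination h
      · rw [Finset.card_image_of_injective _ hinj, Finset.card_erase_of_mem (Finset.mem_univ _),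
          Finset.card_univ, Finset.card_univ, card_proj, ZMod.card]
        simp
    rw [← Finset.sum_image (f := f) (fun a _ b _ h => hinj h), himg, mul_neg_one,
      ← add_eq_zero_iff_eq_neg, Finset.sum_erase_add _ _ (Finset.mem_univ _), hf]

theorem mem_spSub {k : Type} [Field k] {f : Projectivization (ZMod p) (Fin 2 → ZMod p) → k} :
    f ∈ spSub p k ↔ ∑ x, f x = 0 := by
  simp [spSub, LinearMap.mem_ker]

/-- The reduction of `sp` is irreducible, already under transvections. -/
theorem eq_spSub_of_transv_stable {k : Type} [Field k] [CharP k p]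
    (W : Submodule k (Projectivization (ZMod p) (Fin 2 → ZMod p) → k)) (hW : W ≤ spSub p k)
    (hstab : ∀ v t, ∀ f ∈ W, (fun x => f (projAct p (transv p v t) x)) ∈ W) (hne : W ≠ ⊥) :
    W = spSub p k := by
  classical
  set φ : Projectivization (ZMod p) (Fin 2 → ZMod p) →
    Projectivization (ZMod p) (Fin 2 → ZMod p) → k := fun x y => if y = x then 0 else -1 with hφ
  have key : ∀ f ∈ W, ∀ x, f x ≠ 0 → φ x ∈ W := by
    intro f hf x hx
    induction x using Projectivization.ind with
    | h v hv =>
    have hsum : ∑ t, (fun y => f (projAct p (transv p v t) y)) ∈ W :=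
      W.sum_mem fun t _ => hstab v t f hf
    rw [← W.smul_mem_iff hx]
    convert hsum using 1
    ext y
    rw [Finset.sum_apply, sum_projAct_transv p v hv f ((mem_spSub p).1 (hW hf))]
    simp [hφ]
  obtain ⟨f, hf, hf0⟩ := W.exists_mem_ne_zero_of_ne_bot hne
  obtain ⟨x, hx⟩ := Function.ne_iff.1 hf0
  have hall : ∀ y, φ y ∈ W := fun y => by
    by_cases hyx : y = x
    · exact hyx ▸ key f hf x hx
    · exact key _ (key f hf x hx) y (by simp [hφ, hyx])
  refine le_antisymm hW fun h hh => ?_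
  have : h = ∑ x, h x • φ x := by
    ext y
    rw [mem_spSub, ← Finset.add_sum_erase _ _ (Finset.mem_univ y)] at hh
    rw [Finset.sum_apply, ← Finset.add_sum_erase _ _ (Finset.mem_univ y)]
    have : ∀ x ∈ Finset.univ.erase y, (h x • φ x) y = - h x := fun x hx => by
      simp [hφ, (Finset.ne_of_mem_erase hx).symm]
    rw [Finset.sum_congr rfl this, Finset.sum_neg_distrib]
    simpa [hφ] using eq_neg_of_add_eq_zero_left hh
  rw [this]
  exact W.sum_mem fun x _ => W.smul_mem _ (hall x)

theorem finrank_spSub (k : Type) [Field k] : Module.finrank k (spSub p k) = p := by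
  classical
  have hne : (∑ x : Projectivization (ZMod p) (Fin 2 → ZMod p),
      LinearMap.proj x : (Projectivization (ZMod p) (Fin 2 → ZMod p) → k) →ₗ[k] k) ≠ 0 := by
    intro h
    obtain ⟨x⟩ : Nonempty (Projectivization (ZMod p) (Fin 2 → ZMod p)) :=
      Fintype.card_pos_iff.1 (by rw [card_proj]; omega)
    have := LinearMap.congr_fun h (Pi.single x 1)
    simp [LinearMap.sum_apply] at this
  have := Module.Dual.finrank_ker_add_one_of_ne_zero
    (f := ∑ x : Projectivization (ZMod p) (Fin 2 → ZMod p), (LinearMap.proj x : (Projectivization (ZMod p) (Fin 2 → ZMod p) → k) →ₗ[k] k))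
    hne
  rw [Module.finrank_fintype_fun_eq_card, card_proj] at this
  exact Nat.succ_injective this

open MvPolynomial in
/-- The linear form `v₀ X + v₁ Y`. -/
noncomputable def linForm {k : Type} [Field k] (ι : ZMod p →+* k) (v : Fin 2 → ZMod p) :
    MvPolynomial (Fin 2) k :=
  C (ι (v 0)) * X 0 + C (ι (v 1)) * X 1

open MvPolynomial in
theorem linForm_smul {k : Type} [Field k] (ι : ZMod p →+* k) (a : ZMod p) (v : Fin 2 → ZMod p) :
    linForm p ι (a • v) = C (ι a) * linForm p ι v := by
  simp only [linForm, Pi.smul_apply, smul_eq_mul, map_mul]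
  ring

theorem linForm_pow_rep {k : Type} [Field k] (ι : ZMod p →+* k) {v : Fin 2 → ZMod p} (hv : v ≠ 0) :
    linForm p ι (Projectivization.mk (ZMod p) v hv).rep ^ (p - 1) = linForm p ι v ^ (p - 1) := by
  obtain ⟨a, ha⟩ := Projectivization.exists_smul_eq_mk_rep (ZMod p) v hv
  rw [← ha, Units.smul_def, linForm_smul, mul_pow, ← map_pow, ← map_pow,
    ZMod.pow_card_sub_one_eq_one a.ne_zero, map_one, map_one, one_mul]

theorem glSubstAct_linForm {k : Type} [Field k] (ι : ZMod p →+* k)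
    (g : Matrix (Fin 2) (Fin 2) (ZMod p)) (v : Fin 2 → ZMod p) :
    glSubstAct p k ι g (linForm p ι v) = linForm p ι (g.mulVec v) := by
  simp only [glSubstAct, linForm, map_add, map_mul, MvPolynomial.aeval_C, MvPolynomial.aeval_X,
    Matrix.mulVec, dotProduct, Fin.sum_univ_two, MvPolynomial.algebraMap_eq,
    Matrix.cons_val_zero, Matrix.cons_val_one]
  ring

/-- The map `f ↦ ∑ₓ f(x) (x₀ X + x₁ Y)^{p-1}` from functions on `P¹(F_p)` to `Sym^{p-1}`. -/
noncomputable def powSum {k : Type} [Field k] (ι : ZMod p →+* k) :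
    (Projectivization (ZMod p) (Fin 2 → ZMod p) → k) →ₗ[k] MvPolynomial (Fin 2) k :=
  ∑ x, (LinearMap.proj x).smulRight (linForm p ι x.rep ^ (p - 1))

theorem powSum_apply {k : Type} [Field k] (ι : ZMod p →+* k)
    (f : Projectivization (ZMod p) (Fin 2 → ZMod p) → k) :
    powSum p ι f = ∑ x, f x • linForm p ι x.rep ^ (p - 1) := by
  simp [powSum, LinearMap.sum_apply]

open MvPolynomial in
theorem powSum_mem {k : Type} [Field k] (ι : ZMod p →+* k)
    (f : Projectivization (ZMod p) (Fin 2 → ZMod p) → k) :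
    powSum p ι f ∈ homogeneousSubmodule (Fin 2) k (p - 1) := by
  rw [powSum_apply]
  refine Submodule.sum_mem _ fun x _ => Submodule.smul_mem _ _ ?_
  rw [mem_homogeneousSubmodule]
  have : (linForm p ι x.rep).IsHomogeneous 1 :=
    (isHomogeneous_C_mul_X _ _).add (isHomogeneous_C_mul_X _ _)
  simpa using this.pow (p - 1)

theorem glSubstAct_powSum {k : Type} [Field k] (ι : ZMod p →+* k)
    (g : GL (Fin 2) (ZMod p)) (f : Projectivization (ZMod p) (Fin 2 → ZMod p) → k) :
    glSubstAct p k ι (g : Matrix (Fin 2) (Fin 2) (ZMod p)) (powSum p ι f) =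
      powSum p ι (fun x => f (projAct p g⁻¹ x)) := by
  rw [powSum_apply, powSum_apply, map_sum, ← Equiv.sum_comp (projPerm p g)
    fun x => f (projAct p g⁻¹ x) • linForm p ι x.rep ^ (p - 1)]
  refine Finset.sum_congr rfl fun x _ => ?_
  have h1 : projAct p g⁻¹ (projPerm p g x) = x := (projPerm p g).symm_apply_apply x
  have h2 : projPerm p g x = Projectivization.mk (ZMod p) _ (mulVec_ne_zero p g x.rep_nonzero) := by
    rw [← projAct_mk p g x.rep_nonzero, Projectivization.mk_rep]
    rfl
  rw [h1, h2, linForm_pow_rep, map_smul, map_pow, glSubstAct_linForm]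

open MvPolynomial in
theorem powSum_injective {k : Type} [Field k] (ι : ZMod p →+* k)
    {f : Projectivization (ZMod p) (Fin 2 → ZMod p) → k} (hf : f ∈ spSub p k)
    (h0 : powSum p ι f = 0) : f = 0 := by
  classical
  ext y
  have hp : p - 1 ≠ 0 := Nat.sub_ne_zero_of_lt (Fact.out : p.Prime).one_lt
  have h : ∑ x, f x * ι (x.rep 0 * y.rep 1 - x.rep 1 * y.rep 0) ^ (p - 1) = 0 := by
    have := congrArg (eval ![ι (y.rep 1), -ι (y.rep 0)]) h0
    rw [powSum_apply, map_sum, map_zero] at this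
    rw [← this]
    refine Finset.sum_congr rfl fun x _ => ?_
    simp only [linForm, smul_eval, map_pow, map_add, map_mul, eval_C, eval_X,
      Matrix.cons_val_zero, Matrix.cons_val_one, map_sub]
    ring
  have hxy : ∀ x ∈ Finset.univ.erase y,
      f x * ι (x.rep 0 * y.rep 1 - x.rep 1 * y.rep 0) ^ (p - 1) = f x := fun x hx => by
    rw [← map_pow, ZMod.pow_card_sub_one_eq_one, map_one, mul_one]
    intro hc
    apply Finset.ne_of_mem_erase hx
    rw [← x.mk_rep, ← y.mk_rep, projMk_eq_iff]
    exact sub_eq_zero.1 hc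
  rw [← Finset.add_sum_erase _ _ (Finset.mem_univ y), Finset.sum_congr rfl hxy, mul_comm (y.rep 0),
    sub_self, map_zero, zero_pow hp, mul_zero, zero_add] at h
  rw [mem_spSub, ← Finset.add_sum_erase _ _ (Finset.mem_univ y), h, add_zero] at hf
  simpa using hf

open MvPolynomial in
theorem exists_injective_homogeneousSubmodule (k : Type) [Field k] (n : ℕ) :
    ∃ T : homogeneousSubmodule (Fin 2) k n →ₗ[k] (Fin (n + 1) → k), Function.Injective T := by
  refine ⟨LinearMap.pi fun i =>
    (lcoeff k (Finsupp.single 0 (i : ℕ) + Finsupp.single 1 (n - i))).comp (Submodule.subtype _), ?_⟩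
  rw [injective_iff_map_eq_zero]
  rintro ⟨F, hF⟩ h
  rw [mem_homogeneousSubmodule] at hF
  ext d
  by_contra hd
  have hdeg := hF hd
  rw [Finsupp.weight_apply, Finsupp.sum_fintype _ _ (by simp)] at hdeg
  simp only [Pi.one_apply, smul_eq_mul, mul_one, Fin.sum_univ_two] at hdeg
  have := congrFun h ⟨d 0, by omega⟩
  apply hd
  simp only [LinearMap.pi_apply, LinearMap.comp_apply, Submodule.subtype_apply, lcoeff_apply,
    Pi.zero_apply] at this
  simp only [ZeroMemClass.coe_zero, coeff_zero]
  convert this using 2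
  ext i
  fin_cases i <;> simp
  omega

open MvPolynomial in
theorem exists_spSub_equiv {k : Type} [Field k] (ι : ZMod p →+* k) :
    ∃ B : spSub p k ≃ₗ[k] homogeneousSubmodule (Fin 2) k (p - 1),
      ∀ f, (B f : MvPolynomial (Fin 2) k) = powSum p ι f := by
  obtain ⟨T, hT⟩ := exists_injective_homogeneousSubmodule k (p - 1)
  have := FiniteDimensional.of_injective T hT
  have hle : Module.finrank k (homogeneousSubmodule (Fin 2) k (p - 1)) ≤ p := by
    have := LinearMap.finrank_le_finrank_of_injective hT
    rwa [Module.finrank_fintype_fun_eq_card, Fintype.card_fin,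
      Nat.sub_add_cancel (Fact.out : p.Prime).one_le] at this
  let B := ((powSum p ι).codRestrict _ (powSum_mem p ι)).comp (spSub p k).subtype
  have hB : Function.Injective B := by
    rw [injective_iff_map_eq_zero]
    intro f hf
    exact Subtype.ext (powSum_injective p ι f.2 (congrArg Subtype.val hf))
  have heq : Module.finrank k (spSub p k) =
      Module.finrank k (homogeneousSubmodule (Fin 2) k (p - 1)) :=
    le_antisymm (LinearMap.finrank_le_finrank_of_injective hB) (by rwa [finrank_spSub])
  exact ⟨LinearEquiv.ofBijective B
    ⟨hB, (LinearMap.injective_iff_surjective_of_finrank_eq_finrank heq).1 hB⟩, fun f => rfl⟩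

/-- A nonzero map from a finite module over a valuation ring to a finite power of its fraction
field can be rescaled to be integral and to take the value `1` at some coordinate. -/
theorem exists_integral_rescaling {K : Type} [Field K] (𝒪 : ValuationSubring K)
    {L : Type} [AddCommGroup L] [Module 𝒪 L] [Module.Finite 𝒪 L] {P : Type} [Finite P]
    (E : L →ₗ[𝒪] (P → K)) (hE : E ≠ 0) :
    ∃ (c : K) (A : L →ₗ[𝒪] (P → 𝒪)), (∀ l x, (A l x : K) = c * E l x) ∧ ∃ l x, A l x = 1 := by
  obtain ⟨n, s, hs⟩ := Module.Finite.exists_fin (R := 𝒪) (M := L)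
  obtain ⟨i₀, x₀, h₀⟩ : ∃ i x, E (s i) x ≠ 0 := by
    by_contra! h
    exact hE (LinearMap.ext_on_range hs fun i => funext fun x => h i x)
  have : Nonempty (Fin n × P) := ⟨(i₀, x₀)⟩
  obtain ⟨⟨i, x⟩, hmax⟩ := Finite.exists_max fun q : Fin n × P => 𝒪.valuation (E (s q.1) q.2)
  have hne : E (s i) x ≠ 0 := fun h => h₀ <| by
    have := hmax (i₀, x₀)
    simpa [h] using this
  have hint : ∀ l y, (E (s i) x)⁻¹ * E l y ∈ 𝒪 := by
    intro l y
    have hl : l ∈ Submodule.span 𝒪 (Set.range s) := hs ▸ Submodule.mem_top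
    induction hl using Submodule.span_induction with
    | mem l hl =>
      obtain ⟨j, rfl⟩ := hl
      rw [← 𝒪.valuation_le_one_iff, map_mul, map_inv₀, inv_mul_le_iff₀
        (zero_lt_iff.2 ((𝒪.valuation.ne_zero_iff).2 hne)), mul_one]
      exact hmax (j, y)
    | zero => simp [𝒪.zero_mem]
    | add l l' _ _ h h' =>
      rw [map_add, Pi.add_apply, mul_add]
      exact 𝒪.add_mem _ _ h h'
    | smul a l _ h =>
      rw [map_smul, Pi.smul_apply, Algebra.smul_def, mul_left_comm]
      exact 𝒪.mul_mem _ _ a.2 h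
  refine ⟨(E (s i) x)⁻¹,
    { toFun := fun l y => ⟨_, hint l y⟩
      map_add' := fun l l' => by
        ext y
        simp [mul_add]
      map_smul' := fun a l => by
        ext y
        simp [Algebra.smul_def, mul_left_comm] }, fun l y => rfl, s i, x, ?_⟩
  ext
  exact inv_mul_cancel₀ hne

/-- Reduction of an integral `GL₂(F_p)`-lattice of functions on the projective line. -/
theorem exists_reduction_equiv {R : Type} [CommRing R] [IsLocalRing R]
    (ι : ZMod p →+* IsLocalRing.ResidueField R)
    {L : Type} [AddCommGroup L] [Module R L] [Module.Free R L] [Module.Finite R L]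
    (hrank : Module.finrank R L = p)
    (ρ : GL (Fin 2) (ZMod p) →* (L ≃ₗ[R] L)) (m : ℕ)
    (A : L →ₗ[R] (Projectivization (ZMod p) (Fin 2 → ZMod p) → R))
    (hsum : ∀ l, ∑ x, A l x = 0) (hone : ∃ l x, A l x = 1)
    (hA : ∀ g l x, IsLocalRing.residue R (A (ρ g l) x) =
      ι (g : Matrix (Fin 2) (Fin 2) (ZMod p)).det ^ m *
        IsLocalRing.residue R (A l (projAct p g⁻¹ x))) :
    ∃ Ab : TensorProduct R (IsLocalRing.ResidueField R) L ≃ₗ[IsLocalRing.ResidueField R]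
        spSub p (IsLocalRing.ResidueField R),
      ∀ g t x, (Ab (LinearMap.baseChange (IsLocalRing.ResidueField R) (ρ g).toLinearMap t)).1 x =
        ι (g : Matrix (Fin 2) (Fin 2) (ZMod p)).det ^ m * (Ab t).1 (projAct p g⁻¹ x) := by
  have : CharP (IsLocalRing.ResidueField R) p := charP_of_injective_ringHom ι.injective p
  let D : L →ₗ[R] (Projectivization (ZMod p) (Fin 2 → ZMod p) → IsLocalRing.ResidueField R) :=
    (LinearMap.compLeft (Algebra.linearMap R (IsLocalRing.ResidueField R)) _).comp A
  let T := D.liftBaseChange (IsLocalRing.ResidueField R)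
  have hT : ∀ a l x, T (a ⊗ₜ l) x = a * IsLocalRing.residue R (A l x) := fun a l x => by
    simp only [T, LinearMap.liftBaseChange_tmul, Pi.smul_apply, smul_eq_mul]
    rfl
  have hequi : ∀ g t x,
      T (LinearMap.baseChange (IsLocalRing.ResidueField R) (ρ g).toLinearMap t) x =
        ι (g : Matrix (Fin 2) (Fin 2) (ZMod p)).det ^ m * T t (projAct p g⁻¹ x) := by
    intro g t x
    induction t with
    | zero => simp
    | add t t' h h' => rw [map_add, map_add, map_add, Pi.add_apply, Pi.add_apply, h, h', mul_add]
    | tmul a l =>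
      rw [LinearMap.baseChange_tmul, hT, hT, LinearEquiv.coe_coe, hA]
      ring
  have hmem : ∀ t, T t ∈ spSub p (IsLocalRing.ResidueField R) := by
    intro t
    induction t with
    | zero => rw [map_zero]; exact Submodule.zero_mem _
    | add t t' h h' => rw [map_add]; exact Submodule.add_mem _ h h'
    | tmul a l =>
      rw [mem_spSub]
      simp only [hT]
      rw [← Finset.mul_sum, ← map_sum, hsum, map_zero, mul_zero]
  have hrange : LinearMap.range T = spSub p (IsLocalRing.ResidueField R) := by
    apply eq_spSub_of_transv_stable
    · rintro _ ⟨t, rfl⟩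
      exact hmem t
    · rintro v s _ ⟨t, rfl⟩
      refine ⟨LinearMap.baseChange _ (ρ (transv p v s)⁻¹).toLinearMap t, ?_⟩
      ext x
      have hd : ((transv p v s)⁻¹ : GL (Fin 2) (ZMod p)).val.det = 1 := by
        rw [← Matrix.GeneralLinearGroup.val_det_apply, map_inv, det_transv, inv_one, Units.val_one]
      rw [hequi, hd, map_one, one_pow, one_mul, inv_inv]
    · intro h
      obtain ⟨l, x, hlx⟩ := hone
      have h0 : T (1 ⊗ₜ l) = 0 := (Submodule.mem_bot _).1 (h ▸ LinearMap.mem_range_self T _)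
      have := congrFun h0 x
      rw [hT, hlx] at this
      simp at this
  let T' := T.codRestrict _ hmem
  have hsurj : Function.Surjective T' := by
    rintro ⟨f, hf⟩
    obtain ⟨t, rfl⟩ := hrange ▸ hf
    exact ⟨t, rfl⟩
  have heq : Module.finrank (IsLocalRing.ResidueField R)
      (TensorProduct R (IsLocalRing.ResidueField R) L) =
      Module.finrank (IsLocalRing.ResidueField R) (spSub p (IsLocalRing.ResidueField R)) := by
    rw [finrank_spSub, Module.finrank_baseChange, hrank]
  exact ⟨LinearEquiv.ofBijective T'
    ⟨(LinearMap.injective_iff_surjective_of_finrank_eq_finrank heq).2 hsurj, hsurj⟩, hequi⟩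

/-- **Reduction of a lattice in `sp ⊗ (χ∘det)` (CDT Lemma 3.1.1(2)).**
Let `Q̄_p` be an algebraic closure of `ℚ_p` (an algebraically closed algebraic extension
`K`), `𝒪` its valuation ring (the valuation subring whose trace on `ℚ_p` is `ℤ_p`), with
residue field `F̄_p = 𝒪/m̄` (with its embedding `ι` of `F_p`), and let `ã = tl a` denote
Teichmüller lifts.  Let `L` be a finite free `𝒪`-module with an `𝒪`-linear action `ρ` of
`GL₂(F_p)` such that `V = L ⊗ Q̄_p` is irreducible and `V ≅ sp ⊗ (χ∘det)` where
`χ(a) = ã^m`.  Then `L ⊗ F̄_p ≅ σ_{m,p−1} = det^m ⊗ Sym^{p−1}(F̄_p²)` as `F̄_p`-representations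
of `GL₂(F_p)`. -/
theorem statement2
    (K : Type) [Field K] [Algebra ℚ_[p] K] [IsAlgClosed K] [Algebra.IsAlgebraic ℚ_[p] K]
    (𝒪 : ValuationSubring K)
    (h𝒪 : ∀ x : ℚ_[p], algebraMap ℚ_[p] K x ∈ 𝒪 ↔ ‖x‖ ≤ 1)
    (ι : ZMod p →+* IsLocalRing.ResidueField 𝒪)
    (tl : (ZMod p)ˣ →* Kˣ)
    (htl_mem : ∀ a : (ZMod p)ˣ, ((tl a : Kˣ) : K) ∈ 𝒪)
    (htl_root : ∀ a : (ZMod p)ˣ, (tl a) ^ (p - 1) = 1)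
    (htl_res : ∀ (a : (ZMod p)ˣ) (h : ((tl a : Kˣ) : K) ∈ 𝒪),
      IsLocalRing.residue 𝒪 ⟨((tl a : Kˣ) : K), h⟩ = ι (a : ZMod p))
    (L : Type) [AddCommGroup L] [Module 𝒪 L] [Module.Free 𝒪 L] [Module.Finite 𝒪 L]
    (ρ : GL (Fin 2) (ZMod p) →* (L ≃ₗ[𝒪] L))
    -- `V = L ⊗ Q̄_p` is irreducible
    (hVnontriv : Nontrivial (TensorProduct 𝒪 K L))
    (hVirr : ∀ W : Submodule K (TensorProduct 𝒪 K L),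
      (∀ (g : GL (Fin 2) (ZMod p)) (x : TensorProduct 𝒪 K L),
        x ∈ W → LinearMap.baseChange K (ρ g).toLinearMap x ∈ W) →
      W = ⊥ ∨ W = ⊤)
    (m : ℕ)
    -- `V ≅ sp ⊗ (χ∘det)` with `χ(a) = ã^m`
    (hiso : ∃ e : TensorProduct 𝒪 K L ≃ₗ[K] spSub p K,
      ∀ (g : GL (Fin 2) (ZMod p)) (v : TensorProduct 𝒪 K L)
        (x : Projectivization (ZMod p) (Fin 2 → ZMod p)),
        ((e (LinearMap.baseChange K (ρ g).toLinearMap v)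
            : Projectivization (ZMod p) (Fin 2 → ZMod p) → K) x)
          = ((tl (Matrix.GeneralLinearGroup.det g) ^ m : Kˣ) : K)
              * ((e v : Projectivization (ZMod p) (Fin 2 → ZMod p) → K) (projAct p g⁻¹ x))) :
    -- `L ⊗ F̄_p ≅ σ_{m,p−1}`
    ∃ eb : TensorProduct 𝒪 (IsLocalRing.ResidueField 𝒪) L ≃ₗ[IsLocalRing.ResidueField 𝒪]
        (MvPolynomial.homogeneousSubmodule (Fin 2) (IsLocalRing.ResidueField 𝒪) (p - 1)),
      ∀ (g : GL (Fin 2) (ZMod p)) (x : TensorProduct 𝒪 (IsLocalRing.ResidueField 𝒪) L),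
        ((eb (LinearMap.baseChange (IsLocalRing.ResidueField 𝒪) (ρ g).toLinearMap x)
            : MvPolynomial (Fin 2) (IsLocalRing.ResidueField 𝒪)))
          = ι ((g : Matrix (Fin 2) (Fin 2) (ZMod p)).det) ^ m
              • glSubstAct p (IsLocalRing.ResidueField 𝒪) ι
                  (g : Matrix (Fin 2) (Fin 2) (ZMod p))
                  ((eb x : MvPolynomial (Fin 2) (IsLocalRing.ResidueField 𝒪))) := by
  obtain ⟨e, he⟩ := hiso
  let E : L →ₗ[𝒪] (Projectivization (ZMod p) (Fin 2 → ZMod p) → K) :=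
    (((spSub p K).subtype.comp e.toLinearMap).restrictScalars 𝒪).comp (TensorProduct.mk 𝒪 K L 1)
  have hEapp : ∀ l x, E l x = (e (1 ⊗ₜ l)).1 x := fun _ _ => rfl
  have hE : E ≠ 0 := by
    intro h
    have h0 : ∀ t, e t = 0 := by
      intro t
      induction t with
      | zero => exact map_zero e
      | add t t' h h' => rw [map_add, h, h', add_zero]
      | tmul a l =>
        have h1 : e (1 ⊗ₜ l) = 0 := Subtype.ext (LinearMap.congr_fun h l)
        rw [← mul_one a, ← smul_eq_mul, ← TensorProduct.smul_tmul', map_smul, h1, smul_zero]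
    obtain ⟨t, ht⟩ := exists_ne (0 : TensorProduct 𝒪 K L)
    exact ht (e.map_eq_zero_iff.1 (h0 t))
  obtain ⟨c, A, hcA, hone⟩ := exists_integral_rescaling 𝒪 E hE
  have hrank : Module.finrank 𝒪 L = p := by
    rw [← Module.finrank_baseChange (R := K), e.finrank_eq, finrank_spSub]
  have hsum : ∀ l, ∑ x, A l x = 0 := by
    intro l
    apply Subtype.ext
    rw [AddSubmonoidClass.coe_finsetSum]
    simp only [hcA, hEapp]
    rw [← Finset.mul_sum, (mem_spSub p).1 (e (1 ⊗ₜ l)).2, mul_zero]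
    rfl
  have hA : ∀ g l x, IsLocalRing.residue 𝒪 (A (ρ g l) x) =
      ι (g : Matrix (Fin 2) (Fin 2) (ZMod p)).det ^ m *
        IsLocalRing.residue 𝒪 (A l (projAct p g⁻¹ x)) := by
    intro g l x
    have h1 : A (ρ g l) x = ⟨_, htl_mem (Matrix.GeneralLinearGroup.det g)⟩ ^ m *
        A l (projAct p g⁻¹ x) := by
      apply Subtype.ext
      have h2 := he g (1 ⊗ₜ l) x
      rw [LinearMap.baseChange_tmul, LinearEquiv.coe_coe, Units.val_pow_eq_pow_val] at h2
      rw [MulMemClass.coe_mul, SubmonoidClass.coe_pow, hcA, hcA, hEapp, hEapp, h2, mul_left_comm]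
    rw [h1, map_mul, map_pow, htl_res, Matrix.GeneralLinearGroup.val_det_apply]
  obtain ⟨Ab, hAb⟩ := exists_reduction_equiv p ι hrank ρ m A hsum hone hA
  obtain ⟨B, hB⟩ := exists_spSub_equiv p ι
  refine ⟨Ab.trans B, fun g t => ?_⟩
  rw [LinearEquiv.trans_apply, LinearEquiv.trans_apply, hB, hB, glSubstAct_powSum, ← map_smul]
  congr 1
  ext x
  exact hAb g t x
end

section
/- There exists an F̄_p-linear map θ: ind 1 → ind (Sym^{p−1}(F̄_p²))* which is G-equivariant (θ(g·f) = g·θ(f) for all g ∈ G) and satisfies θ∘T = T∘θ (with T the transpose Hecke operator on each side), and which has the following property: for every λ ∈ F̄_p and every f ∈ ind 1 with T f = λ f and θ(f) = 0, the function f factors through the determinant, i.e. there is f₀: ℚ_p^× → F̄_p with f(g) = f₀(det g) for all g ∈ G. -/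
variable (p : ℕ) [Fact p.Prime]

/-- `K = GL₂(ℤ_p)` as a subgroup of `G = GL₂(ℚ_p)`: the image of the units of the matrix
ring over `ℤ_p`. -/
noncomputable def Ksub : Subgroup (GL (Fin 2) ℚ_[p]) :=
  (Units.map (RingHom.mapMatrix (PadicInt.Coe.ringHom (p := p))
    : Matrix (Fin 2) (Fin 2) ℤ_[p] →+* Matrix (Fin 2) (Fin 2) ℚ_[p]).toMonoidHom).range

/-- The centre `Z ≅ ℚ_p^×` of `GL₂(ℚ_p)` (the scalar matrices). -/
noncomputable def Zsub : Subgroup (GL (Fin 2) ℚ_[p]) :=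
  (Units.map (algebraMap ℚ_[p] (Matrix (Fin 2) (Fin 2) ℚ_[p])).toMonoidHom).range

/-- The subgroup `KZ` of `GL₂(ℚ_p)`. -/
noncomputable def KZsub : Subgroup (GL (Fin 2) ℚ_[p]) := Ksub p ⊔ Zsub p

/-- The element of `GL₂(ℚ_p)` attached to a unit of the matrix ring over `ℤ_p`. -/
noncomputable def glOfZ (u : (Matrix (Fin 2) (Fin 2) ℤ_[p])ˣ) : GL (Fin 2) ℚ_[p] :=
  Units.map (RingHom.mapMatrix (PadicInt.Coe.ringHom (p := p))
    : Matrix (Fin 2) (Fin 2) ℤ_[p] →+* Matrix (Fin 2) (Fin 2) ℚ_[p]).toMonoidHom u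

/-- The scalar matrix in `GL₂(ℚ_p)` attached to a unit of `ℚ_p`. -/
noncomputable def scalarGLQp (u : ℚ_[p]ˣ) : GL (Fin 2) ℚ_[p] :=
  Units.map (algebraMap ℚ_[p] (Matrix (Fin 2) (Fin 2) ℚ_[p])).toMonoidHom u

/-- `Sym^{p-1}(F̄_p²)`: homogeneous polynomials of degree `p-1` in `X = X 0`, `Y = X 1`. -/
noncomputable abbrev SymSpace : Type :=
  MvPolynomial.homogeneousSubmodule (Fin 2) (AlgebraicClosure (ZMod p)) (p - 1)

open MvPolynomial in
/-- The substitution action of a matrix `(a b; c d)` over `F_p` on polynomials over `F̄_p`: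
`F(X,Y) ↦ F(aX+cY, bX+dY)`. -/
noncomputable def symSubstAct (m : Matrix (Fin 2) (Fin 2) (ZMod p)) :
    MvPolynomial (Fin 2) (AlgebraicClosure (ZMod p))
      →ₐ[AlgebraicClosure (ZMod p)] MvPolynomial (Fin 2) (AlgebraicClosure (ZMod p)) :=
  aeval ![C (algebraMap (ZMod p) (AlgebraicClosure (ZMod p)) (m 0 0)) * X 0
      + C (algebraMap (ZMod p) (AlgebraicClosure (ZMod p)) (m 1 0)) * X 1,
    C (algebraMap (ZMod p) (AlgebraicClosure (ZMod p)) (m 0 1)) * X 0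
      + C (algebraMap (ZMod p) (AlgebraicClosure (ZMod p)) (m 1 1)) * X 1]

/-- The Hecke operator `(T f)(g) = Σ_{yKZ ∈ G/KZ} φ_T(y)·f(y⁻¹g)` on `c-ind σ`, written
via a choice of coset representatives. -/
noncomputable def heckeT {W : Type} [AddCommMonoid W] [Module (AlgebraicClosure (ZMod p)) W]
    (φT : GL (Fin 2) ℚ_[p] → (W →ₗ[AlgebraicClosure (ZMod p)] W))
    (f : GL (Fin 2) ℚ_[p] → W) : GL (Fin 2) ℚ_[p] → W :=
  fun g => ∑ᶠ c : GL (Fin 2) ℚ_[p] ⧸ KZsub p, φT c.out (f ((c.out)⁻¹ * g))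

/-- `ind 1`: functions `f : G → F̄_p` with `f(hg) = f(g)` for `h ∈ KZ`  (for the trivial
representation `1` one has `ind 1* = ind 1`). -/
def indOne : Set (GL (Fin 2) ℚ_[p] → AlgebraicClosure (ZMod p)) :=
  {f | ∀ (h : KZsub p) (g : GL (Fin 2) ℚ_[p]), f (↑h * g) = f g}

/-- `c-ind 1`: members of `ind 1` supported on finitely many cosets `KZg`. -/
def cIndOne : Set (GL (Fin 2) ℚ_[p] → AlgebraicClosure (ZMod p)) :=
  {f | (∀ (h : KZsub p) (g : GL (Fin 2) ℚ_[p]), f (↑h * g) = f g) ∧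
    Set.Finite ((Quotient.mk (QuotientGroup.rightRel (KZsub p))) '' Function.support f)}

/-- `ind σ*` for `σ` a representation of `KZ` on `Sym^{p-1}(F̄_p²)`: functions
`F : G → (Sym^{p-1})*` with `F(hg) = σ*(h)F(g)` for `h ∈ KZ`. -/
def indDualSym (σ : (KZsub p) →* (SymSpace p ≃ₗ[AlgebraicClosure (ZMod p)] SymSpace p)) :
    Set (GL (Fin 2) ℚ_[p] → Module.Dual (AlgebraicClosure (ZMod p)) (SymSpace p)) :=
  {F | ∀ (h : KZsub p) (g : GL (Fin 2) ℚ_[p]) (v : SymSpace p),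
    F (↑h * g) v = F g ((σ h).symm v)}

/-- `c-ind σ` for `σ` a representation of `KZ` on `Sym^{p-1}(F̄_p²)`. -/
def cIndSym (σ : (KZsub p) →* (SymSpace p ≃ₗ[AlgebraicClosure (ZMod p)] SymSpace p)) :
    Set (GL (Fin 2) ℚ_[p] → SymSpace p) :=
  {f | (∀ (h : KZsub p) (g : GL (Fin 2) ℚ_[p]), f (↑h * g) = σ h (f g)) ∧
    Set.Finite ((Quotient.mk (QuotientGroup.rightRel (KZsub p))) '' Function.support f)}

/-- The pairing between `c-ind 1` and `ind 1* = ind 1`. -/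
noncomputable def pairingOne (f F : GL (Fin 2) ℚ_[p] → AlgebraicClosure (ZMod p)) :
    AlgebraicClosure (ZMod p) :=
  ∑ᶠ c : Quotient (QuotientGroup.rightRel (KZsub p)), F c.out * f c.out

/-- The pairing between `c-ind σ` and `ind σ*` for `σ` on `Sym^{p-1}(F̄_p²)`. -/
noncomputable def pairingSym (f : GL (Fin 2) ℚ_[p] → SymSpace p)
    (F : GL (Fin 2) ℚ_[p] → Module.Dual (AlgebraicClosure (ZMod p)) (SymSpace p)) :
    AlgebraicClosure (ZMod p) :=
  ∑ᶠ c : Quotient (QuotientGroup.rightRel (KZsub p)), F c.out (f c.out)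


section TransposeHecke

local notation "𝔽" => AlgebraicClosure (ZMod p)
local notation "𝔾" => GL (Fin 2) ℚ_[p]

variable {p} {W : Type} [AddCommGroup W] [Module (AlgebraicClosure (ZMod p)) W]

open Classical in
/-- The element of `c-ind σ` supported on `KZ g₀` with value `v` at `g₀`. -/
noncomputable def deltaInd (σ : KZsub p →* (W ≃ₗ[𝔽] W)) (g₀ : 𝔾) (v : W) : 𝔾 → W :=
  fun x => if h : x * g₀⁻¹ ∈ KZsub p then σ ⟨x * g₀⁻¹, h⟩ v else 0

lemma deltaInd_mul (σ : KZsub p →* (W ≃ₗ[𝔽] W)) (g₀ : 𝔾) (v : W) (h : KZsub p) :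
    deltaInd σ g₀ v (h * g₀) = σ h v := by
  have e : (h : 𝔾) * g₀ * g₀⁻¹ = h := by group
  simp [deltaInd, e]

lemma deltaInd_eq_zero (σ : KZsub p →* (W ≃ₗ[𝔽] W)) (g₀ : 𝔾) (v : W) {x : 𝔾}
    (hx : x * g₀⁻¹ ∉ KZsub p) : deltaInd σ g₀ v x = 0 := by
  simp [deltaInd, hx]

lemma deltaInd_equivariant (σ : KZsub p →* (W ≃ₗ[𝔽] W)) (g₀ : 𝔾) (v : W) (h : KZsub p) (x : 𝔾) :
    deltaInd σ g₀ v (h * x) = σ h (deltaInd σ g₀ v x) := by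
  by_cases hx : x * g₀⁻¹ ∈ KZsub p
  · have e : x = ((⟨x * g₀⁻¹, hx⟩ : KZsub p) : 𝔾) * g₀ := by simp
    rw [e, deltaInd_mul, ← mul_assoc, ← Subgroup.coe_mul, deltaInd_mul, map_mul]
    rfl
  · rw [deltaInd_eq_zero σ g₀ v hx, deltaInd_eq_zero, map_zero]
    rwa [mul_assoc, Subgroup.mul_mem_cancel_left _ h.2]

lemma deltaInd_finite (σ : KZsub p →* (W ≃ₗ[𝔽] W)) (g₀ : 𝔾) (v : W) :
    Set.Finite ((Quotient.mk (QuotientGroup.rightRel (KZsub p))) ''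
      Function.support (deltaInd σ g₀ v)) := by
  refine (Set.finite_singleton (Quotient.mk (QuotientGroup.rightRel (KZsub p)) g₀)).subset ?_
  rintro _ ⟨x, hx, rfl⟩
  refine Quotient.sound ?_
  change QuotientGroup.rightRel (KZsub p) x g₀
  rw [QuotientGroup.rightRel_apply]
  by_contra h
  refine hx (deltaInd_eq_zero σ g₀ v fun h' => h ?_)
  simpa using inv_mem h'

lemma heckeT_deltaInd (σ : KZsub p →* (W ≃ₗ[𝔽] W)) (φ : 𝔾 → (W →ₗ[𝔽] W))
    (hφ : ∀ (x : 𝔾) (h : KZsub p) (w : W), φ (x * h) w = φ x (σ h w)) (g₀ : 𝔾) (v : W) (g : 𝔾) :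
    heckeT p φ (deltaInd σ g₀ v) g = φ (g * g₀⁻¹) v := by
  unfold heckeT
  rw [finsum_eq_single _ (QuotientGroup.mk (g * g₀⁻¹))]
  · set c : 𝔾 := (QuotientGroup.mk (g * g₀⁻¹) : 𝔾 ⧸ KZsub p).out with hc
    have h : c⁻¹ * (g * g₀⁻¹) ∈ KZsub p := by
      rw [← QuotientGroup.eq, hc]
      exact Quotient.out_eq' _
    have e : c⁻¹ * g = ((⟨_, h⟩ : KZsub p) : 𝔾) * g₀ := by simp [mul_assoc]
    rw [e, deltaInd_mul, ← hφ]
    simp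
  · intro c hc
    rw [deltaInd_eq_zero, map_zero]
    intro h
    rw [mul_assoc, ← QuotientGroup.eq] at h
    exact hc (by rw [← h]; exact (Quotient.out_eq' c).symm)

lemma mk_out_mul (x : 𝔾) : ∃ h : KZsub p,
    (Quotient.mk (QuotientGroup.rightRel (KZsub p)) x).out = h * x := by
  have h := Quotient.exact (Quotient.out_eq (Quotient.mk (QuotientGroup.rightRel (KZsub p)) x))
  change QuotientGroup.rightRel (KZsub p) _ _ at h
  rw [QuotientGroup.rightRel_apply] at h
  exact ⟨⟨_, inv_mem h⟩, by simp⟩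

lemma transpose_hecke_apply (σ : KZsub p →* (W ≃ₗ[𝔽] W)) (φ : 𝔾 → (W →ₗ[𝔽] W))
    (hφ : ∀ (x : 𝔾) (h : KZsub p) (w : W), φ (x * h) w = φ x (σ h w))
    (F F' : 𝔾 → Module.Dual 𝔽 W)
    (hF' : ∀ (h : KZsub p) (g : 𝔾) (v : W), F' (h * g) v = F' g ((σ h).symm v))
    (adj : ∀ f : 𝔾 → W, (∀ (h : KZsub p) (g : 𝔾), f (h * g) = σ h (f g)) →
      Set.Finite ((Quotient.mk (QuotientGroup.rightRel (KZsub p))) '' Function.support f) →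
      (∑ᶠ c : Quotient (QuotientGroup.rightRel (KZsub p)), F c.out (heckeT p φ f c.out)) =
        ∑ᶠ c : Quotient (QuotientGroup.rightRel (KZsub p)), F' c.out (f c.out))
    (g : 𝔾) (v : W) :
    F' g v = ∑ᶠ c : Quotient (QuotientGroup.rightRel (KZsub p)),
      F c.out (φ (c.out * g⁻¹) v) := by
  have h := adj _ (deltaInd_equivariant σ g v) (deltaInd_finite σ g v)
  simp only [heckeT_deltaInd σ φ hφ] at h
  rw [h, finsum_eq_single _ (Quotient.mk (QuotientGroup.rightRel (KZsub p)) g)]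
  · obtain ⟨k, hk⟩ := mk_out_mul g
    rw [hk, deltaInd_mul, hF', LinearEquiv.symm_apply_apply]
  · intro c hc
    rw [deltaInd_eq_zero, map_zero]
    intro h
    refine hc ?_
    rw [← Quotient.out_eq c]
    refine Quotient.sound ?_
    change QuotientGroup.rightRel (KZsub p) _ _
    rw [QuotientGroup.rightRel_apply]
    simpa using inv_mem h

end TransposeHecke

section GroupFacts

variable {p}

local notation "𝔾" => GL (Fin 2) ℚ_[p]
local notation "𝕌" => (Matrix (Fin 2) (Fin 2) ℤ_[p])ˣ

lemma glOfZ_apply (u : 𝕌) (i j : Fin 2) :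
    (glOfZ p u : Matrix (Fin 2) (Fin 2) ℚ_[p]) i j = ((u.val i j : ℤ_[p]) : ℚ_[p]) := rfl

lemma glOfZ_mul (u v : 𝕌) : glOfZ p (u * v) = glOfZ p u * glOfZ p v := map_mul _ _ _

lemma glOfZ_inv (u : 𝕌) : glOfZ p u⁻¹ = (glOfZ p u)⁻¹ := map_inv _ _

lemma scalarGLQp_val (z : ℚ_[p]ˣ) :
    (scalarGLQp p z : Matrix (Fin 2) (Fin 2) ℚ_[p]) = !![(z : ℚ_[p]), 0; 0, (z : ℚ_[p])] := by
  ext i j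
  fin_cases i <;> fin_cases j <;> simp [scalarGLQp, Matrix.algebraMap_matrix_apply]

lemma scalarGLQp_comm (z : ℚ_[p]ˣ) (g : 𝔾) : scalarGLQp p z * g = g * scalarGLQp p z :=
  Units.ext (Algebra.commutes (z : ℚ_[p]) (g : Matrix (Fin 2) (Fin 2) ℚ_[p]))

lemma glOfZ_mem (u : 𝕌) : glOfZ p u ∈ KZsub p := Subgroup.mem_sup_left ⟨u, rfl⟩

lemma scalarGLQp_mem (z : ℚ_[p]ˣ) : scalarGLQp p z ∈ KZsub p := Subgroup.mem_sup_right ⟨z, rfl⟩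

lemma mem_KZsub_iff (g : 𝔾) :
    g ∈ KZsub p ↔ ∃ (u : 𝕌) (z : ℚ_[p]ˣ), g = glOfZ p u * scalarGLQp p z := by
  constructor
  · intro h
    have : (Zsub p).Normal := by
      refine ⟨?_⟩
      rintro _ ⟨z, rfl⟩ g
      refine ⟨z, ?_⟩
      change scalarGLQp p z = g * scalarGLQp p z * g⁻¹
      rw [← scalarGLQp_comm]
      group
    obtain ⟨_, ⟨u, rfl⟩, _, ⟨z, rfl⟩, rfl⟩ := Subgroup.mem_sup_of_normal_right.mp h
    exact ⟨u, z, rfl⟩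
  · rintro ⟨u, z, rfl⟩
    exact mul_mem (glOfZ_mem u) (scalarGLQp_mem z)

/-- The unit of the matrix ring over `ℤ_p` with given entries and unit determinant. -/
noncomputable def unitOfEntries (a b c d : ℤ_[p]) (h : IsUnit (a * d - b * c)) : 𝕌 :=
  Matrix.nonsingInvUnit !![a, b; c, d] (by rwa [Matrix.det_fin_two_of])

lemma unitOfEntries_val (a b c d : ℤ_[p]) (h : IsUnit (a * d - b * c)) :
    (unitOfEntries a b c d h).val = !![a, b; c, d] := rfl

lemma isUnit_det_entries (u : 𝕌) :
    IsUnit (u.val 0 0 * u.val 1 1 - u.val 0 1 * u.val 1 0) := by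
  rw [← Matrix.det_fin_two]
  exact (Matrix.isUnit_iff_isUnit_det _).mp u.isUnit

lemma toZMod_eq_zero_iff (x : ℤ_[p]) : PadicInt.toZMod x = 0 ↔ (p : ℤ_[p]) ∣ x := by
  rw [← RingHom.mem_ker, PadicInt.ker_toZMod, PadicInt.maximalIdeal_eq_span_p,
    Ideal.mem_span_singleton]

lemma isUnit_of_toZMod_ne_zero {x : ℤ_[p]} (h : PadicInt.toZMod x ≠ 0) : IsUnit x := by
  by_contra hx
  rw [PadicInt.not_isUnit_iff, PadicInt.norm_lt_one_iff_dvd, ← toZMod_eq_zero_iff] at hx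
  exact h hx

/-- The bottom row modulo `p` of an element of `GL₂(ℤ_p)`. -/
noncomputable def botRow (u : 𝕌) : Fin 2 → ZMod p := fun j => PadicInt.toZMod (u.val 1 j)

lemma botRow_mul (u v : 𝕌) :
    botRow (u * v) = Matrix.vecMul (botRow u) (v.val.map PadicInt.toZMod) := by
  ext j
  simp [botRow, Matrix.mul_apply, Matrix.vecMul, dotProduct]

lemma botRow_ne_zero (u : 𝕌) : botRow u ≠ 0 := by
  intro h
  have h0 : PadicInt.toZMod (u.val 1 0) = 0 := congrFun h 0
  have h1 : PadicInt.toZMod (u.val 1 1) = 0 := congrFun h 1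
  have := (isUnit_det_entries u).map (PadicInt.toZMod (p := p))
  simp [h0, h1] at this

lemma exists_botRow_eq (r : Fin 2 → ZMod p) (hr : r ≠ 0) : ∃ u : 𝕌, botRow u = r := by
  obtain ⟨a, ha⟩ := ZMod.ringHom_surjective (PadicInt.toZMod (p := p)) (r 0)
  obtain ⟨b, hb⟩ := ZMod.ringHom_surjective (PadicInt.toZMod (p := p)) (r 1)
  by_cases h1 : r 1 = 0
  · have h0 : r 0 ≠ 0 := fun h0 => hr (by ext j; fin_cases j <;> simp [h0, h1])
    refine ⟨unitOfEntries 0 1 a b ?_, ?_⟩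
    · simpa using isUnit_of_toZMod_ne_zero (ha ▸ h0)
    · ext j; fin_cases j <;> simp [botRow, unitOfEntries_val, ha, hb]
  · refine ⟨unitOfEntries 1 0 a b ?_, ?_⟩
    · simpa using isUnit_of_toZMod_ne_zero (hb ▸ h1)
    · ext j; fin_cases j <;> simp [botRow, unitOfEntries_val, ha, hb]

/-- An element of `GL₂(ℤ_p)` whose bottom row reduces to `r` modulo `p`
(the identity for `r = 0`). -/
noncomputable def liftRow (r : Fin 2 → ZMod p) : 𝕌 :=
  open Classical in if h : r ≠ 0 then (exists_botRow_eq r h).choose else 1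

lemma botRow_liftRow {r : Fin 2 → ZMod p} (hr : r ≠ 0) : botRow (liftRow r) = r := by
  rw [liftRow, dif_pos hr]
  exact (exists_botRow_eq r hr).choose_spec

/-- The determinant of the pair of rows `r`, `s`; it vanishes when they are proportional. -/
def crossRow (r s : Fin 2 → ZMod p) : ZMod p := r 0 * s 1 - r 1 * s 0

lemma crossRow_mul_right_eq_zero (w u : 𝕌) :
    crossRow (botRow (w * u)) (botRow u) = 0 ↔ PadicInt.toZMod (w.val 1 0) = 0 := by
  have e : crossRow (botRow (w * u)) (botRow u) = PadicInt.toZMod (w.val 1 0) *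
      PadicInt.toZMod (u.val 0 0 * u.val 1 1 - u.val 0 1 * u.val 1 0) := by
    simp [crossRow, botRow, Matrix.mul_apply, Fin.sum_univ_two]
    ring
  rw [e]
  have h := ((isUnit_det_entries u).map (PadicInt.toZMod (p := p))).ne_zero
  simp only [mul_eq_zero, h, or_false]

lemma p_ne_zero_padic : (p : ℚ_[p]) ≠ 0 := by
  exact_mod_cast (Fact.out : p.Prime).ne_zero

section Alpha

variable (α : GL (Fin 2) ℚ_[p])
  (hα : (α : Matrix (Fin 2) (Fin 2) ℚ_[p]) = !![1, 0; 0, ((p : ℚ_[p]))⁻¹])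

include hα

lemma alpha_conj_mem_iff (w : 𝕌) :
    α * glOfZ p w * α⁻¹ ∈ KZsub p ↔ PadicInt.toZMod (w.val 1 0) = 0 := by
  have hp := p_ne_zero_padic (p := p)
  rw [toZMod_eq_zero_iff]
  constructor
  · intro h
    obtain ⟨u, z, h⟩ := (mem_KZsub_iff _).mp h
    rw [mul_inv_eq_iff_eq_mul] at h
    have hm := congrArg (fun x : 𝔾 => (x : Matrix (Fin 2) (Fin 2) ℚ_[p])) h
    simp only [Units.val_mul, hα, scalarGLQp_val] at hm
    have h10 := congrFun (congrFun hm 1) 0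
    simp [Matrix.mul_apply, Fin.sum_univ_two, glOfZ_apply] at h10
    have hd := congrArg Matrix.det hm
    simp only [Matrix.det_mul, Matrix.det_fin_two_of] at hd
    simp only [Matrix.det_fin_two, glOfZ_apply] at hd
    have hw := (isUnit_det_entries w)
    have hu := (isUnit_det_entries u)
    rw [PadicInt.isUnit_iff, PadicInt.norm_def] at hw hu
    push_cast at hw hu
    have hd' : ((w.val 0 0 : ℚ_[p]) * w.val 1 1 - w.val 0 1 * w.val 1 0) =
      (u.val 0 0 * u.val 1 1 - u.val 0 1 * u.val 1 0) * (z * z : ℚ_[p]) := by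
      linear_combination p * hd - (w.val 0 0 * w.val 1 1 - w.val 0 1 * w.val 1 0 -
        (u.val 0 0 * u.val 1 1 - u.val 0 1 * u.val 1 0) * (z * z : ℚ_[p])) *
        mul_inv_cancel₀ hp
    have hz : ‖(z : ℚ_[p])‖ = 1 := by
      have := congrArg norm hd'
      rw [norm_mul, hw, hu, one_mul, norm_mul] at this
      nlinarith [norm_nonneg (z : ℚ_[p])]
    obtain ⟨z', hz'⟩ : ∃ z' : ℤ_[p], (z' : ℚ_[p]) = z := ⟨⟨z, hz.le⟩, rfl⟩
    refine ⟨u.val 1 0 * z', ?_⟩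
    apply PadicInt.ext
    rw [PadicInt.coe_mul, PadicInt.coe_mul, PadicInt.coe_natCast, hz']
    field_simp at h10
    linear_combination h10
  · rintro ⟨c, hc⟩
    have hu := isUnit_det_entries w
    rw [hc] at hu
    have : α * glOfZ p w * α⁻¹ =
        glOfZ p (unitOfEntries (w.val 0 0) (p * w.val 0 1) c (w.val 1 1)
          (by convert hu using 1; ring)) := by
      rw [mul_inv_eq_iff_eq_mul]
      apply Units.ext
      ext i j
      simp only [Units.val_mul, hα, Matrix.mul_apply, Fin.sum_univ_two, glOfZ_apply,
        unitOfEntries_val]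
      fin_cases i <;> fin_cases j <;> simp [hc]
      · field_simp
      · field_simp
      · exact mul_comm _ _
    rw [this]
    exact glOfZ_mem _

lemma alpha_mul_rel_iff (u v : 𝕌) :
    (α * glOfZ p u) * (α * glOfZ p v)⁻¹ ∈ KZsub p ↔ crossRow (botRow u) (botRow v) = 0 := by
  have h := crossRow_mul_right_eq_zero (u * v⁻¹) v
  rw [inv_mul_cancel_right] at h
  rw [h, ← alpha_conj_mem_iff α hα, glOfZ_mul, glOfZ_inv]
  simp only [mul_inv_rev, mul_assoc]

lemma alpha_mul_alpha_mem (u v : 𝕌) (hv : botRow v 1 = 0) :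
    α * glOfZ p v * (α * glOfZ p u) ∈ KZsub p := by
  have hp := p_ne_zero_padic (p := p)
  let w : 𝕌 := unitOfEntries 0 1 1 0 (by simp)
  have hw : α * glOfZ p w * α ∈ KZsub p := by
    rw [mem_KZsub_iff]
    refine ⟨w, (Units.mk0 (p : ℚ_[p]) hp)⁻¹, ?_⟩
    apply Units.ext
    ext i j
    simp only [Units.val_mul, hα, Matrix.mul_apply, Fin.sum_univ_two, glOfZ_apply,
        w, unitOfEntries_val, scalarGLQp_val]
    fin_cases i <;> fin_cases j <;> simp
  have h := (alpha_mul_rel_iff α hα v w).mpr (by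
    simp [crossRow, hv]; simp [botRow, w, unitOfEntries_val])
  have := mul_mem (mul_mem h hw) (glOfZ_mem u)
  convert this using 1
  group

end Alpha

end GroupFacts

section RowEvaluation

variable {p}

local notation "𝔽" => AlgebraicClosure (ZMod p)
local notation "𝕌" => (Matrix (Fin 2) (Fin 2) ℤ_[p])ˣ

/-- Evaluation of `F ∈ Sym^{p-1}` at the row vector `r` over `F_p`. -/
noncomputable def evRow (r : Fin 2 → ZMod p) : SymSpace p →ₗ[𝔽] 𝔽 :=
  (MvPolynomial.aeval (fun i => algebraMap (ZMod p) 𝔽 (r i))).toLinearMap ∘ₗ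
    Submodule.subtype _

lemma evRow_apply (r : Fin 2 → ZMod p) (v : SymSpace p) :
    evRow r v = MvPolynomial.aeval (fun i => algebraMap (ZMod p) 𝔽 (r i))
      (v : MvPolynomial (Fin 2) 𝔽) := rfl

lemma evRow_eq_sum (r : Fin 2 → ZMod p) (v : SymSpace p) :
    evRow r v = ∑ d ∈ (v : MvPolynomial (Fin 2) 𝔽).support,
      (v : MvPolynomial (Fin 2) 𝔽).coeff d *
        (algebraMap (ZMod p) 𝔽 (r 0) ^ d 0 * algebraMap (ZMod p) 𝔽 (r 1) ^ d 1) := by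
  rw [evRow_apply, MvPolynomial.aeval_eq_eval₂Hom, MvPolynomial.coe_eval₂Hom,
    MvPolynomial.eval₂_eq']
  simp [Fin.prod_univ_two]

lemma degree_of_mem_support (v : SymSpace p) {d : Fin 2 →₀ ℕ}
    (hd : d ∈ (v : MvPolynomial (Fin 2) 𝔽).support) : d 0 + d 1 = p - 1 := by
  have h := (MvPolynomial.mem_homogeneousSubmodule _ _).mp v.2
  have := h (MvPolynomial.mem_support_iff.mp hd)
  rw [← this, Finsupp.weight_apply, Finsupp.sum_fintype _ _ (by simp)]
  simp [Fin.sum_univ_two]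

lemma evRow_smul (c : ZMod p) (r : Fin 2 → ZMod p) (v : SymSpace p) :
    evRow (c • r) v = algebraMap (ZMod p) 𝔽 c ^ (p - 1) * evRow r v := by
  rw [evRow_eq_sum, evRow_eq_sum, Finset.mul_sum]
  refine Finset.sum_congr rfl fun d hd => ?_
  have e : algebraMap (ZMod p) 𝔽 c ^ (p - 1) =
      algebraMap (ZMod p) 𝔽 c ^ d 0 * algebraMap (ZMod p) 𝔽 c ^ d 1 := by
    rw [← degree_of_mem_support v hd, pow_add]
  rw [e]
  simp only [Pi.smul_apply, smul_eq_mul, map_mul, mul_pow]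
  ring

lemma prime_sub_one_ne_zero : p - 1 ≠ 0 := by
  have := (Fact.out : p.Prime).two_le
  omega

lemma pow_prime_sub_one (c : ZMod p) : c ^ (p - 1) = if c = 0 then 0 else 1 := by
  split_ifs with h
  · rw [h, zero_pow prime_sub_one_ne_zero]
  · exact ZMod.pow_card_sub_one_eq_one h

lemma evRow_smul_of_ne_zero {c : ZMod p} (hc : c ≠ 0) (r : Fin 2 → ZMod p) (v : SymSpace p) :
    evRow (c • r) v = evRow r v := by
  rw [evRow_smul, ← map_pow, pow_prime_sub_one, if_neg hc, map_one, one_mul]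

lemma evRow_zero (v : SymSpace p) : evRow 0 v = 0 := by
  have := evRow_smul 0 0 v
  rwa [smul_zero, map_zero, zero_pow prime_sub_one_ne_zero, zero_mul] at this

lemma sum_evRow (v : SymSpace p) : ∑ r : Fin 2 → ZMod p, evRow r v = 0 := by
  simp only [evRow_eq_sum]
  rw [Finset.sum_comm]
  refine Finset.sum_eq_zero fun d hd => ?_
  have hdeg := degree_of_mem_support v hd
  rw [← Finset.mul_sum, ← (finTwoArrowEquiv (ZMod p)).symm.sum_comp, Fintype.sum_prod_type]
  simp only [finTwoArrowEquiv_symm_apply, Matrix.cons_val_zero, Matrix.cons_val_one,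
    ← map_pow, ← Finset.mul_sum, ← Finset.sum_mul, ← map_sum]
  by_cases h : d 0 < p - 1
  · rw [FiniteField.sum_pow_lt_card_sub_one (ZMod p) _ (by rwa [ZMod.card])]
    simp
  · have := prime_sub_one_ne_zero (p := p)
    rw [FiniteField.sum_pow_lt_card_sub_one (ZMod p) (d 1) (by rw [ZMod.card]; omega)]
    simp

lemma evRow_of_eq_symSubstAct {m : Matrix (Fin 2) (Fin 2) (ZMod p)} {v w : SymSpace p}
    (h : (w : MvPolynomial (Fin 2) 𝔽) = symSubstAct p m v) (r : Fin 2 → ZMod p) :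
    evRow r w = evRow (Matrix.vecMul r m) v := by
  rw [evRow_apply, evRow_apply, h, symSubstAct, ← AlgHom.comp_apply, MvPolynomial.comp_aeval]
  congr 2
  ext i
  fin_cases i <;> simp [Matrix.vecMul, dotProduct, Fin.sum_univ_two] <;> ring

/-- The `(p-1)`-st power of the linear form vanishing on the line through `s`. -/
noncomputable def crossPow (s : Fin 2 → ZMod p) : SymSpace p :=
  ⟨(MvPolynomial.C (algebraMap (ZMod p) 𝔽 (s 1)) * MvPolynomial.X 0 -
      MvPolynomial.C (algebraMap (ZMod p) 𝔽 (s 0)) * MvPolynomial.X 1) ^ (p - 1), by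
    rw [MvPolynomial.mem_homogeneousSubmodule]
    have h := (((MvPolynomial.isHomogeneous_X 𝔽 (0 : Fin 2)).C_mul
      (algebraMap (ZMod p) 𝔽 (s 1))).sub ((MvPolynomial.isHomogeneous_X 𝔽 (1 : Fin 2)).C_mul
      (algebraMap (ZMod p) 𝔽 (s 0)))).pow (p - 1)
    rwa [one_mul] at h⟩

lemma evRow_crossPow (r s : Fin 2 → ZMod p) :
    evRow r (crossPow s) = if crossRow r s = 0 then 0 else 1 := by
  have : evRow r (crossPow s) = algebraMap (ZMod p) 𝔽 (crossRow r s ^ (p - 1)) := by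
    rw [evRow_apply, crossPow, crossRow]
    simp [mul_comm]
  rw [this, pow_prime_sub_one]
  split_ifs <;> simp

section Sigma

variable (σ₂ : (KZsub p) →* (SymSpace p ≃ₗ[AlgebraicClosure (ZMod p)] SymSpace p))
  (hσK : ∀ (u : (Matrix (Fin 2) (Fin 2) ℤ_[p])ˣ) (hu : glOfZ p u ∈ KZsub p)
    (F : SymSpace p),
    ((σ₂ ⟨glOfZ p u, hu⟩ F : MvPolynomial (Fin 2) (AlgebraicClosure (ZMod p))))
      = symSubstAct p ((u : Matrix (Fin 2) (Fin 2) ℤ_[p]).map (PadicInt.toZMod))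
          (F : MvPolynomial (Fin 2) (AlgebraicClosure (ZMod p))))
  (π : ℚ_[p]ˣ) (hπ : (π : ℚ_[p]) = (p : ℚ_[p]))
  (hσp : ∀ hmem : scalarGLQp p π ∈ KZsub p, σ₂ ⟨scalarGLQp p π, hmem⟩ = 1)

include hσK in
lemma evRow_sigma_glOfZ (u : 𝕌) (r : Fin 2 → ZMod p) (v : SymSpace p) :
    evRow r (σ₂ ⟨glOfZ p u, glOfZ_mem u⟩ v) =
      evRow (Matrix.vecMul r (u.val.map PadicInt.toZMod)) v :=
  evRow_of_eq_symSubstAct (hσK u _ v) r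

lemma exists_unit_mul_zpow (hπ : (π : ℚ_[p]) = (p : ℚ_[p])) (z : ℚ_[p]ˣ) :
    ∃ (x : ℤ_[p]ˣ) (n : ℤ), z = Units.map (PadicInt.Coe.ringHom (p := p)).toMonoidHom x * π ^ n := by
  have hp := p_ne_zero_padic (p := p)
  have hn : ‖(z : ℚ_[p]) * (p : ℚ_[p]) ^ (-(z : ℚ_[p]).valuation)‖ = 1 := by
    rw [norm_mul, Padic.norm_eq_zpow_neg_valuation z.ne_zero, Padic.norm_p_zpow, neg_neg,
      ← zpow_add₀ (by exact_mod_cast (Fact.out : p.Prime).ne_zero)]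
    simp
  refine ⟨PadicInt.mkUnits hn, (z : ℚ_[p]).valuation, Units.ext ?_⟩
  rw [Units.val_mul, Units.val_zpow_eq_zpow_val, hπ]
  change _ = (z : ℚ_[p]) * (p : ℚ_[p]) ^ (-(z : ℚ_[p]).valuation) * _
  rw [mul_assoc, ← zpow_add₀ hp]
  simp

include hσK hπ hσp in
lemma evRow_sigma_scalar (z : ℚ_[p]ˣ) (r : Fin 2 → ZMod p) (v : SymSpace p) :
    evRow r (σ₂ ⟨scalarGLQp p z, scalarGLQp_mem z⟩ v) = evRow r v := by
  let τ : ℚ_[p]ˣ →* (SymSpace p ≃ₗ[AlgebraicClosure (ZMod p)] SymSpace p) :=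
    σ₂.comp ((Units.map (algebraMap ℚ_[p] (Matrix (Fin 2) (Fin 2) ℚ_[p])).toMonoidHom).codRestrict
      (KZsub p) scalarGLQp_mem)
  change evRow r (τ z v) = evRow r v
  have hτ : τ π = 1 := hσp _
  obtain ⟨x, n, rfl⟩ := exists_unit_mul_zpow π hπ z
  rw [map_mul, map_zpow, hτ, one_zpow, mul_one]
  let u : 𝕌 := Units.map (algebraMap ℤ_[p] (Matrix (Fin 2) (Fin 2) ℤ_[p])).toMonoidHom x
  have hu : scalarGLQp p (Units.map (PadicInt.Coe.ringHom (p := p)).toMonoidHom x) = glOfZ p u := by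
    apply Units.ext
    rw [scalarGLQp_val]
    ext i j
    rw [glOfZ_apply]
    fin_cases i <;> fin_cases j <;> simp [u, Matrix.algebraMap_matrix_apply] <;> rfl
  have e : τ (Units.map (PadicInt.Coe.ringHom (p := p)).toMonoidHom x) =
      σ₂ ⟨glOfZ p u, glOfZ_mem u⟩ := congrArg σ₂ (Subtype.ext hu)
  rw [e, evRow_sigma_glOfZ σ₂ hσK]
  have hx : Matrix.vecMul r (u.val.map PadicInt.toZMod) = PadicInt.toZMod (x : ℤ_[p]) • r := by
    ext j
    fin_cases j <;>
      simp [u, Matrix.vecMul, dotProduct, Matrix.algebraMap_matrix_apply, mul_comm]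
  rw [hx, evRow_smul_of_ne_zero (x.isUnit.map (PadicInt.toZMod (p := p))).ne_zero]

end Sigma

end RowEvaluation

section Neighbours

variable {p}

local notation "𝔽" => AlgebraicClosure (ZMod p)
local notation "𝔾" => GL (Fin 2) ℚ_[p]
local notation "𝕌" => (Matrix (Fin 2) (Fin 2) ℤ_[p])ˣ

variable (α : GL (Fin 2) ℚ_[p])
  (hα : (α : Matrix (Fin 2) (Fin 2) ℚ_[p]) = !![1, 0; 0, ((p : ℚ_[p]))⁻¹])

/-- A representative of the coset in `KZ\KZαKZ` attached to the row vector `r` over `F_p`. -/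
noncomputable def nbr (r : Fin 2 → ZMod p) : 𝔾 := α * glOfZ p (liftRow r)

include hα in
lemma nbr_rel_iff {r s : Fin 2 → ZMod p} (hr : r ≠ 0) (hs : s ≠ 0) :
    nbr α r * (nbr α s)⁻¹ ∈ KZsub p ↔ crossRow r s = 0 := by
  rw [nbr, nbr, alpha_mul_rel_iff α hα, botRow_liftRow hr, botRow_liftRow hs]

lemma crossRow_eq_zero_iff {s : Fin 2 → ZMod p} (hs : s ≠ 0) (r : Fin 2 → ZMod p) :
    crossRow r s = 0 ↔ ∃ c : ZMod p, c • s = r := by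
  constructor
  · intro h
    rw [crossRow, sub_eq_zero] at h
    by_cases h1 : s 1 = 0
    · have h0 : s 0 ≠ 0 := fun h0 => hs (by ext j; fin_cases j <;> simp [h0, h1])
      refine ⟨r 0 / s 0, ?_⟩
      ext j
      fin_cases j
      · simp [h0]
      · simp only [h1, mul_zero] at h
        have := (mul_eq_zero.mp h.symm).resolve_right h0
        simp [h1, this]
    · refine ⟨r 1 / s 1, ?_⟩
      ext j
      fin_cases j
      · simp only [Fin.zero_eta, Pi.smul_apply, smul_eq_mul]
        field_simp
        linear_combination -h
      · simp [h1]
  · rintro ⟨c, rfl⟩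
    simp [crossRow]
    ring

lemma card_proportional {s : Fin 2 → ZMod p} (hs : s ≠ 0) :
    (Finset.univ.filter fun r : Fin 2 → ZMod p => r ≠ 0 ∧ crossRow r s = 0).card = p - 1 := by
  have hinj : Function.Injective fun c : (ZMod p)ˣ => (c : ZMod p) • s := by
    intro c d h
    exact Units.ext (smul_left_injective (ZMod p) hs h)
  have : (Finset.univ.filter fun r : Fin 2 → ZMod p => r ≠ 0 ∧ crossRow r s = 0) =
      Finset.univ.image fun c : (ZMod p)ˣ => (c : ZMod p) • s := by
    ext r
    simp only [Finset.mem_filter, Finset.mem_univ, true_and, Finset.mem_image,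
      crossRow_eq_zero_iff hs]
    constructor
    · rintro ⟨hr, c, rfl⟩
      exact ⟨Units.mk0 c fun h => hr (by rw [h, zero_smul]), rfl⟩
    · rintro ⟨c, rfl⟩
      exact ⟨smul_ne_zero c.ne_zero hs, c, rfl⟩
  rw [this, Finset.card_image_of_injective _ hinj, Finset.card_univ, ZMod.card_units]

lemma cast_prime_sub_one : ((p - 1 : ℕ) : 𝔽) = -1 := by
  rw [Nat.cast_sub (Fact.out : p.Prime).one_le, CharP.cast_eq_zero, Nat.cast_one, zero_sub]

include hα in
lemma finsum_double_coset (Φ : 𝔾 → 𝔽) (hΦ : ∀ (h : KZsub p) (x : 𝔾), Φ (h * x) = Φ x) (g : 𝔾)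
    (hsupp : ∀ x, Φ x ≠ 0 → ∃ h₁ ∈ KZsub p, ∃ h₂ ∈ KZsub p, x * g⁻¹ = h₁ * α * h₂) :
    ∑ᶠ c : Quotient (QuotientGroup.rightRel (KZsub p)), Φ c.out =
      - ∑ r : Fin 2 → ZMod p with r ≠ 0, Φ (nbr α r * g) := by
  classical
  let q : (Fin 2 → ZMod p) → Quotient (QuotientGroup.rightRel (KZsub p)) :=
    fun r => Quotient.mk _ (nbr α r * g)
  have hq : ∀ r, Φ (q r).out = Φ (nbr α r * g) := by
    intro r
    obtain ⟨h, e⟩ := mk_out_mul (nbr α r * g)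
    simp only [q, e, hΦ]
  have hrel : ∀ x y : 𝔾, y * x⁻¹ ∈ KZsub p ↔
      Quotient.mk (QuotientGroup.rightRel (KZsub p)) x = Quotient.mk _ y := by
    intro x y
    rw [Quotient.eq, QuotientGroup.rightRel_apply]
  have hsub : Function.support (fun c : Quotient (QuotientGroup.rightRel (KZsub p)) => Φ c.out) ⊆
      ((Finset.univ.filter fun r : Fin 2 → ZMod p => r ≠ 0).image q : Finset _) := by
    intro c hc
    obtain ⟨h₁, hh₁, h₂, hh₂, e⟩ := hsupp _ hc
    obtain ⟨u, z, rfl⟩ := (mem_KZsub_iff _).mp hh₂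
    refine Finset.mem_coe.mpr (Finset.mem_image.mpr ⟨botRow u, by simp [botRow_ne_zero], ?_⟩)
    refine Eq.trans ?_ (Quotient.out_eq c)
    rw [← hrel]
    have hm := (alpha_mul_rel_iff α hα u (liftRow (botRow u))).mpr (by
      rw [botRow_liftRow (botRow_ne_zero u), crossRow]; ring)
    have := mul_mem hh₁ (mul_mem (scalarGLQp_mem z) hm)
    convert this using 1
    rw [mul_inv_rev, ← mul_assoc, e, nbr, ← scalarGLQp_comm z (glOfZ p u), mul_assoc h₁ α,
      ← mul_assoc α (scalarGLQp p z), ← scalarGLQp_comm z α]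
    group
  rw [finsum_eq_sum_of_support_subset _ hsub]
  have hcomp := Finset.sum_comp (s := Finset.univ.filter fun r : Fin 2 → ZMod p => r ≠ 0)
    (fun c : Quotient (QuotientGroup.rightRel (KZsub p)) => Φ c.out) q
  simp only [hq] at hcomp
  rw [hcomp, ← Finset.sum_neg_distrib]
  refine Finset.sum_congr rfl fun c hc => ?_
  obtain ⟨s, hs, rfl⟩ := Finset.mem_image.mp hc
  have hs0 : s ≠ 0 := (Finset.mem_filter.mp hs).2
  have hcard : (Finset.filter (fun r => q r = q s)
      (Finset.univ.filter fun r : Fin 2 → ZMod p => r ≠ 0)).card = p - 1 := by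
    rw [Finset.filter_filter, ← card_proportional hs0]
    congr 1
    ext r
    simp only [Finset.mem_filter, Finset.mem_univ, true_and]
    refine and_congr_right fun hr => ?_
    rw [← nbr_rel_iff α hα hr hs0, eq_comm, ← hrel]
    have : nbr α r * g * (nbr α s * g)⁻¹ = nbr α r * (nbr α s)⁻¹ := by group
    rw [this]
  rw [hcard, nsmul_eq_mul, cast_prime_sub_one]
  ring

lemma apply_eq_of_mul_inv_mem {F : 𝔾 → 𝔽} (hF : F ∈ indOne p) {x y : 𝔾}
    (h : x * y⁻¹ ∈ KZsub p) : F x = F y := by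
  have := hF ⟨_, h⟩ y
  simpa using this

/-- The map `ind 1 → ind (Sym^{p-1})*`: sum over the row vectors over `F_p` of the value at
the corresponding neighbour times evaluation at the row. -/
noncomputable def theta (F : 𝔾 → 𝔽) (g : 𝔾) : Module.Dual 𝔽 (SymSpace p) :=
  ∑ r : Fin 2 → ZMod p, F (nbr α r * g) • evRow r

lemma theta_apply (F : 𝔾 → 𝔽) (g : 𝔾) (v : SymSpace p) :
    theta α F g v = ∑ r : Fin 2 → ZMod p, F (nbr α r * g) * evRow r v := by
  simp [theta]

variable (σ₂ : (KZsub p) →* (SymSpace p ≃ₗ[AlgebraicClosure (ZMod p)] SymSpace p))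
  (hσK : ∀ (u : (Matrix (Fin 2) (Fin 2) ℤ_[p])ˣ) (hu : glOfZ p u ∈ KZsub p)
    (F : SymSpace p),
    ((σ₂ ⟨glOfZ p u, hu⟩ F : MvPolynomial (Fin 2) (AlgebraicClosure (ZMod p))))
      = symSubstAct p ((u : Matrix (Fin 2) (Fin 2) ℤ_[p]).map (PadicInt.toZMod))
          (F : MvPolynomial (Fin 2) (AlgebraicClosure (ZMod p))))
  (π : ℚ_[p]ˣ) (hπ : (π : ℚ_[p]) = (p : ℚ_[p]))
  (hσp : ∀ hmem : scalarGLQp p π ∈ KZsub p, σ₂ ⟨scalarGLQp p π, hmem⟩ = 1)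

include hα hσK in
lemma theta_glOfZ_mul {F : 𝔾 → 𝔽} (hF : F ∈ indOne p) (u : 𝕌) (g : 𝔾) (v : SymSpace p) :
    theta α F (glOfZ p u * g) (σ₂ ⟨glOfZ p u, glOfZ_mem u⟩ v) = theta α F g v := by
  have hinv (x : 𝕌) (r : Fin 2 → ZMod p) : Matrix.vecMul (Matrix.vecMul r
      (x.val.map PadicInt.toZMod)) (x⁻¹.val.map PadicInt.toZMod) = r := by
    rw [Matrix.vecMul_vecMul, ← Matrix.map_mul, Units.mul_inv,
      Matrix.map_one _ (map_zero _) (map_one _), Matrix.vecMul_one]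
  let e : (Fin 2 → ZMod p) ≃ (Fin 2 → ZMod p) :=
    { toFun := fun r => Matrix.vecMul r (u.val.map PadicInt.toZMod)
      invFun := fun r => Matrix.vecMul r (u⁻¹.val.map PadicInt.toZMod)
      left_inv := hinv u
      right_inv := fun r => by simp }
  rw [theta_apply, theta_apply, ← e.sum_comp (fun r => F (nbr α r * g) * evRow r v)]
  refine Finset.sum_congr rfl fun r _ => ?_
  rw [evRow_sigma_glOfZ σ₂ hσK]
  change F _ * evRow (e r) v = F _ * evRow (e r) v
  by_cases hr : r = 0
  · have : e r = 0 := by simp [e, hr]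
    rw [this, evRow_zero]
    simp [hr]
  · have hr' : e r ≠ 0 := by
      intro h
      apply hr
      rw [← e.symm_apply_apply r, h]
      simp [e]
    congr 1
    apply apply_eq_of_mul_inv_mem hF
    have := (alpha_mul_rel_iff α hα (liftRow r * u) (liftRow (e r))).mpr (by
      rw [botRow_liftRow hr', botRow_mul, botRow_liftRow hr]
      simp only [e, Equiv.coe_fn_mk, crossRow]
      ring)
    convert this using 1
    rw [nbr, nbr, glOfZ_mul]
    group

include hα hσK hπ hσp in
lemma theta_mem {F : 𝔾 → 𝔽} (hF : F ∈ indOne p) : theta α F ∈ indDualSym p σ₂ := by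
  rintro ⟨h, hh⟩ g v
  obtain ⟨u, z, rfl⟩ := (mem_KZsub_iff h).mp hh
  obtain ⟨w, rfl⟩ := (σ₂ ⟨glOfZ p u * scalarGLQp p z, hh⟩).surjective v
  rw [LinearEquiv.symm_apply_apply]
  have e : (⟨glOfZ p u * scalarGLQp p z, hh⟩ : KZsub p) =
    ⟨glOfZ p u, glOfZ_mem u⟩ * ⟨scalarGLQp p z, scalarGLQp_mem z⟩ := rfl
  rw [e, map_mul, LinearEquiv.mul_apply, Subgroup.coe_mul, mul_assoc,
    theta_glOfZ_mul α hα σ₂ hσK hF, theta_apply, theta_apply]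
  refine Finset.sum_congr rfl fun r _ => ?_
  rw [evRow_sigma_scalar σ₂ hσK π hπ hσp, ← mul_assoc, ← scalarGLQp_comm, mul_assoc]
  rw [hF ⟨scalarGLQp p z, scalarGLQp_mem z⟩]

lemma evRow_of_eq_aeval {v w : SymSpace p}
    (h : (w : MvPolynomial (Fin 2) 𝔽) = MvPolynomial.aeval ![0, MvPolynomial.X 1]
      (v : MvPolynomial (Fin 2) 𝔽)) (s : Fin 2 → ZMod p) :
    evRow s w = evRow (s 1 • ![0, 1]) v := by
  rw [evRow_apply, evRow_apply, h, ← AlgHom.comp_apply, MvPolynomial.comp_aeval]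
  congr 2
  ext i
  fin_cases i <;> simp

include hσK in
lemma evRow_phi_nbr (φT2 : 𝔾 → (SymSpace p →ₗ[𝔽] SymSpace p))
    (hφα : ∀ F : SymSpace p, ((φT2 α F : MvPolynomial (Fin 2) 𝔽))
        = MvPolynomial.aeval ![0, MvPolynomial.X 1] (F : MvPolynomial (Fin 2) 𝔽))
    (hφ : ∀ (x : 𝔾) (h : KZsub p) (w : SymSpace p), φT2 (x * h) w = φT2 x (σ₂ h w))
    {r : Fin 2 → ZMod p} (hr : r ≠ 0) (s : Fin 2 → ZMod p) (v : SymSpace p) :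
    evRow s (φT2 (nbr α r) v) = if s 1 = 0 then 0 else evRow r v := by
  have h := hφ α ⟨glOfZ p (liftRow r), glOfZ_mem _⟩ v
  change φT2 (nbr α r) v = _ at h
  rw [h, evRow_of_eq_aeval (hφα _)]
  split_ifs with hs
  · rw [hs, zero_smul, evRow_zero]
  · rw [evRow_smul_of_ne_zero hs, evRow_sigma_glOfZ σ₂ hσK]
    congr 2
    nth_rw 2 [← botRow_liftRow hr]
    ext j
    simp [botRow, Matrix.vecMul, dotProduct]

include hα in
lemma sum_nbr_nbr {F : 𝔾 → 𝔽} (hF : F ∈ indOne p) (r : Fin 2 → ZMod p) (g : 𝔾) :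
    ∑ s : Fin 2 → ZMod p with s ≠ 0, F (nbr α s * (nbr α r * g)) =
      (∑ s : Fin 2 → ZMod p, if s 1 = 0 then 0 else F (nbr α s * (nbr α r * g))) - F g := by
  have h1 : ∑ s : Fin 2 → ZMod p with s ≠ 0 ∧ crossRow s ![1, 0] = 0,
      F (nbr α s * (nbr α r * g)) = - F g := by
    rw [Finset.sum_congr rfl (g := fun _ => F g), Finset.sum_const,
      card_proportional (fun h => by simpa using congrFun h 0), nsmul_eq_mul, cast_prime_sub_one,
      neg_one_mul]
    intro s hs
    simp only [Finset.mem_filter, Finset.mem_univ, true_and] at hs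
    rw [← mul_assoc]
    apply apply_eq_of_mul_inv_mem hF
    rw [mul_inv_cancel_right]
    apply alpha_mul_alpha_mem α hα
    rw [botRow_liftRow hs.1]
    simpa [crossRow] using hs.2
  have h2 : (∑ s : Fin 2 → ZMod p, if s 1 = 0 then 0 else F (nbr α s * (nbr α r * g))) =
      ∑ s : Fin 2 → ZMod p with s ≠ 0 ∧ ¬ crossRow s ![1, 0] = 0,
        F (nbr α s * (nbr α r * g)) := by
    rw [Finset.sum_filter]
    refine Finset.sum_congr rfl fun s _ => ?_
    by_cases hs : s 1 = 0
    · simp [hs, crossRow]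
    · have : s ≠ 0 := fun h => hs (by simp [h])
      simp [hs, crossRow, this]
  rw [h2, sub_eq_add_neg, ← h1, add_comm, ← Finset.filter_filter, ← Finset.filter_filter,
    Finset.sum_filter_add_sum_filter_not]

include hα in
lemma apply_nbr_eq_of_theta_eq_zero {F : 𝔾 → 𝔽} (hF : F ∈ indOne p) (hθ : theta α F = 0)
    {r s : Fin 2 → ZMod p} (hr : r ≠ 0) (hs : s ≠ 0) (g : 𝔾) :
    F (nbr α r * g) = F (nbr α s * g) := by
  have key : ∀ s : Fin 2 → ZMod p, s ≠ 0 → F (nbr α s * g) =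
      - ∑ r : Fin 2 → ZMod p with r ≠ 0, F (nbr α r * g) := by
    intro s hs
    have h0 : theta α F g (crossPow s) = 0 := by rw [hθ]; rfl
    rw [theta_apply] at h0
    have h1 : ∑ r : Fin 2 → ZMod p with r ≠ 0 ∧ crossRow r s = 0, F (nbr α r * g) =
        - F (nbr α s * g) := by
      rw [Finset.sum_congr rfl (g := fun _ => F (nbr α s * g)), Finset.sum_const,
        card_proportional hs, nsmul_eq_mul, cast_prime_sub_one, neg_one_mul]
      intro r hr
      simp only [Finset.mem_filter, Finset.mem_univ, true_and] at hr
      apply apply_eq_of_mul_inv_mem hF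
      rw [mul_inv_rev, mul_assoc, mul_inv_cancel_left]
      exact (nbr_rel_iff α hα hr.1 hs).mpr hr.2
    have h2 : ∑ r : Fin 2 → ZMod p with r ≠ 0 ∧ ¬ crossRow r s = 0, F (nbr α r * g) = 0 := by
      rw [← h0, Finset.sum_filter]
      refine Finset.sum_congr rfl fun r _ => ?_
      rw [evRow_crossPow]
      by_cases hr : crossRow r s = 0
      · simp [hr]
      · have : r ≠ 0 := fun h => hr (by simp [h, crossRow])
        simp [hr, this]
    rw [← Finset.sum_filter_add_sum_filter_not _ (fun r => crossRow r s = 0),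
      Finset.filter_filter, Finset.filter_filter, h1, h2, add_zero, neg_neg]
  rw [key r hr, key s hs]

end Neighbours

section Determinant

variable {p}

local notation "𝔽" => AlgebraicClosure (ZMod p)
local notation "𝔾" => GL (Fin 2) ℚ_[p]
local notation "𝕌" => (Matrix (Fin 2) (Fin 2) ℤ_[p])ˣ

/-- The upper unipotent matrix with entry `x`. -/
noncomputable def upperUnip (x : ℚ_[p]) : 𝔾 :=
  Matrix.GeneralLinearGroup.mkOfDetNeZero !![1, x; 0, 1] (by simp)

lemma upperUnip_val (x : ℚ_[p]) :
    (upperUnip x : Matrix (Fin 2) (Fin 2) ℚ_[p]) = !![1, x; 0, 1] := rfl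

/-- The antidiagonal permutation matrix over `ℤ_p`. -/
noncomputable def weylUnit : 𝕌 := unitOfEntries 0 1 1 0 (by simp)

lemma glOfZ_weylUnit_val :
    (glOfZ p weylUnit : Matrix (Fin 2) (Fin 2) ℚ_[p]) = !![0, 1; 1, 0] := by
  ext i j
  rw [glOfZ_apply]
  fin_cases i <;> fin_cases j <;> simp [weylUnit, unitOfEntries_val]

lemma mem_of_det_eq_one {S : Subgroup 𝔾} (hw : glOfZ p weylUnit ∈ S)
    (hu : ∀ x, upperUnip x ∈ S) {g : 𝔾} (hg : (g : Matrix (Fin 2) (Fin 2) ℚ_[p]).det = 1) :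
    g ∈ S := by
  have hlow : ∀ x, glOfZ p weylUnit * upperUnip x * glOfZ p weylUnit ∈ S :=
    fun x => mul_mem (mul_mem hw (hu x)) hw
  have hlow_val : ∀ x : ℚ_[p], ((glOfZ p weylUnit * upperUnip x * glOfZ p weylUnit : 𝔾) :
      Matrix (Fin 2) (Fin 2) ℚ_[p]) = !![1, 0; x, 1] := by
    intro x
    simp [Units.val_mul, glOfZ_weylUnit_val, upperUnip_val]
  have main : ∀ g : 𝔾, (g : Matrix (Fin 2) (Fin 2) ℚ_[p]).det = 1 →
      (g : Matrix (Fin 2) (Fin 2) ℚ_[p]) 1 0 ≠ 0 → g ∈ S := by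
    intro g hg hc
    rw [Matrix.det_fin_two] at hg
    have e : g = upperUnip ((g 0 0 - 1) / g 1 0) *
        (glOfZ p weylUnit * upperUnip (g 1 0) * glOfZ p weylUnit) *
        upperUnip ((g 1 1 - 1) / g 1 0) := by
      apply Units.ext
      rw [Units.val_mul, Units.val_mul, hlow_val, upperUnip_val, upperUnip_val]
      ext i j
      fin_cases i <;> fin_cases j <;>
        simp [Matrix.mul_apply, Fin.sum_univ_two] <;> field_simp <;>
        first | linear_combination -hg | ring
    rw [e]
    exact mul_mem (mul_mem (hu _) (hlow _)) (hu _)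
  by_cases hc : (g : Matrix (Fin 2) (Fin 2) ℚ_[p]) 1 0 = 0
  · have ha : (g : Matrix (Fin 2) (Fin 2) ℚ_[p]) 0 0 ≠ 0 := by
      intro ha
      rw [Matrix.det_fin_two, ha, hc] at hg
      simp at hg
    refine (Subgroup.mul_mem_cancel_left S (hlow 1)).mp (main _ ?_ ?_)
    · rw [Units.val_mul, Matrix.det_mul, hg, hlow_val]
      simp
    · rw [Units.val_mul, hlow_val]
      simp [Matrix.mul_apply, Fin.sum_univ_two, hc, ha]
  · exact main g hg hc

variable (α : GL (Fin 2) ℚ_[p])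
  (hα : (α : Matrix (Fin 2) (Fin 2) ℚ_[p]) = !![1, 0; 0, ((p : ℚ_[p]))⁻¹])

include hα in
lemma upperUnip_mem {S : Subgroup 𝔾} (hK : ∀ u : 𝕌, glOfZ p u ∈ S)
    (hKα : ∀ u : 𝕌, α * glOfZ p u * α⁻¹ ∈ S) (x : ℚ_[p]) : upperUnip x ∈ S := by
  have hp := p_ne_zero_padic (p := p)
  have hint : ∀ y : ℤ_[p], upperUnip (y : ℚ_[p]) ∈ S := by
    intro y
    have e : upperUnip (y : ℚ_[p]) = glOfZ p (unitOfEntries 1 y 0 1 (by simp)) := by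
      apply Units.ext
      ext i j
      rw [glOfZ_apply, upperUnip_val, unitOfEntries_val]
      fin_cases i <;> fin_cases j <;> simp
    rw [e]
    exact hK _
  have hstep : ∀ y : ℚ_[p], upperUnip ((p : ℚ_[p]) ^ 2 * y) ∈ S → upperUnip y ∈ S := by
    intro y hy
    obtain ⟨D, hDval⟩ : ∃ D : 𝔾, (D : Matrix (Fin 2) (Fin 2) ℚ_[p]) =
        !![(p : ℚ_[p]), 0; 0, (p : ℚ_[p])⁻¹] :=
      ⟨Matrix.GeneralLinearGroup.mkOfDetNeZero _ (by simp [hp]), rfl⟩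
    have hDα : D * glOfZ p weylUnit * α = α * glOfZ p weylUnit := by
      apply Units.ext
      simp only [Units.val_mul, hDval, hα, glOfZ_weylUnit_val]
      ext i j
      fin_cases i <;> fin_cases j <;> simp [hp]
    have hDS : D ∈ S := by
      rw [eq_mul_inv_of_mul_eq (eq_mul_inv_of_mul_eq hDα)]
      exact mul_mem (hKα _) (inv_mem (hK _))
    have hconj : D * upperUnip y = upperUnip ((p : ℚ_[p]) ^ 2 * y) * D := by
      apply Units.ext
      rw [Units.val_mul, Units.val_mul, hDval, upperUnip_val, upperUnip_val]
      ext i j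
      fin_cases i <;> fin_cases j <;> simp
      field_simp
    have := mul_mem hy hDS
    rw [← hconj] at this
    exact (Subgroup.mul_mem_cancel_left S hDS).mp this
  have hiter : ∀ (n : ℕ) (y : ℚ_[p]), upperUnip (((p : ℚ_[p]) ^ 2) ^ n * y) ∈ S →
      upperUnip y ∈ S := by
    intro n
    induction n with
    | zero => intro y hy; simpa using hy
    | succ n ih =>
      intro y hy
      refine ih y (hstep _ ?_)
      rwa [← mul_assoc, ← pow_succ']
  obtain ⟨n, hn⟩ := exists_pow_lt_of_lt_one (x := (‖x‖ + 1)⁻¹) (y := ‖(p : ℚ_[p]) ^ 2‖)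
    (by positivity) (by
      rw [norm_pow]
      exact pow_lt_one₀ (norm_nonneg _) Padic.norm_p_lt_one two_ne_zero)
  have hle : ‖((p : ℚ_[p]) ^ 2) ^ n * x‖ ≤ 1 := by
    rw [norm_mul, norm_pow]
    have h1 : (‖x‖ + 1)⁻¹ * (‖x‖ + 1) = 1 := inv_mul_cancel₀ (by positivity)
    have h2 := mul_le_mul_of_nonneg_right hn.le (norm_nonneg x)
    have h3 : 0 < (‖x‖ + 1)⁻¹ := by positivity
    linarith
  exact hiter n x (hint ⟨_, hle⟩)

include hα in
lemma factors_through_det_of_theta_eq_zero {F : 𝔾 → 𝔽} (hF : F ∈ indOne p)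
    (hθ : theta α F = 0) :
    ∃ F₀ : ℚ_[p] → 𝔽, ∀ g : 𝔾, F g = F₀ ((g : Matrix (Fin 2) (Fin 2) ℚ_[p]).det) := by
  classical
  have hrow : ∀ (u : 𝕌) (g : 𝔾), F (α * glOfZ p u * g) = F (nbr α (botRow u) * g) := by
    intro u g
    apply apply_eq_of_mul_inv_mem hF
    have := (alpha_mul_rel_iff α hα u (liftRow (botRow u))).mpr (by
      rw [botRow_liftRow (botRow_ne_zero u), crossRow]; ring)
    convert this using 1
    rw [nbr]
    group
  have hconst : ∀ (u : 𝕌) (g : 𝔾), F (α * glOfZ p u * g) = F (α * g) := by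
    intro u g
    have h1 := hrow 1 g
    have e : glOfZ p (1 : 𝕌) = 1 := map_one _
    rw [e, mul_one] at h1
    rw [hrow, h1]
    exact apply_nbr_eq_of_theta_eq_zero α hα hF hθ (botRow_ne_zero _) (botRow_ne_zero _) g
  let S : Subgroup 𝔾 :=
    { carrier := {h | ∀ g, F (h * g) = F g}
      one_mem' := fun g => by rw [one_mul]
      mul_mem' := fun {a b} ha hb g => by rw [mul_assoc, ha, hb]
      inv_mem' := fun {a} ha g => by rw [← ha (a⁻¹ * g), mul_inv_cancel_left] }
  have hK : ∀ u : 𝕌, glOfZ p u ∈ S := fun u g => hF ⟨_, glOfZ_mem u⟩ g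
  have hKα : ∀ u : 𝕌, α * glOfZ p u * α⁻¹ ∈ S := by
    intro u g
    rw [mul_assoc _ α⁻¹, hconst, mul_inv_cancel_left]
  refine ⟨fun d => if h : ∃ g : 𝔾, (g : Matrix (Fin 2) (Fin 2) ℚ_[p]).det = d then F h.choose
    else 0, fun g => ?_⟩
  have hex : ∃ g' : 𝔾, (g' : Matrix (Fin 2) (Fin 2) ℚ_[p]).det =
    (g : Matrix (Fin 2) (Fin 2) ℚ_[p]).det := ⟨g, rfl⟩
  simp only [dif_pos hex]
  have hdet : ((g * hex.choose⁻¹ : 𝔾) : Matrix (Fin 2) (Fin 2) ℚ_[p]).det = 1 := by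
    have h := congrArg (fun x : 𝔾 => (x : Matrix (Fin 2) (Fin 2) ℚ_[p]).det)
      (inv_mul_cancel_right g hex.choose)
    simp only [Units.val_mul, Matrix.det_mul, hex.choose_spec] at h ⊢
    have hne : (g : Matrix (Fin 2) (Fin 2) ℚ_[p]).det ≠ 0 :=
      ((Matrix.isUnit_iff_isUnit_det _).mp g.isUnit).ne_zero
    exact mul_right_cancel₀ hne (by rw [h, one_mul])
  have hS : g * hex.choose⁻¹ ∈ S :=
    mem_of_det_eq_one (hK _) (upperUnip_mem α hα hK hKα) hdet
  have := hS hex.choose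
  rwa [inv_mul_cancel_right] at this

end Determinant

/-- **Kisin's morphism `ind 1 → ind (Sym^{p−1} F̄_p²)*` (dual form of CDM Lemma 1.5.5).**
Let `p` be an odd prime, `G = GL₂(ℚ_p)`, `K = GL₂(ℤ_p)`, `Z` the centre.  Let `σ₂` be the
representation of `KZ` on `Sym^{p−1}(F̄_p²)` where `K` acts through reduction mod `p` and the
scalar `p` acts trivially, let `α = diag(1, p⁻¹)`, let `φ_T` be the Barthel–Livné
bi-equivariant functions supported on `KZαKZ` attached to the trivial representation and to
`Sym^{p−1}(F̄_p²)` respectively, with the corresponding Hecke operators `T` on `c-ind`, and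
let `T'` be the transpose Hecke operators on `ind 1` and `ind (Sym^{p−1})*`, characterized by
`⟨Tf, F⟩ = ⟨f, T'F⟩`.  Then there is an `F̄_p`-linear `G`-equivariant map
`θ : ind 1 → ind (Sym^{p−1})*` with `θ∘T' = T'∘θ`, such that for every `λ ∈ F̄_p`, every
`f ∈ ind 1` with `T'f = λf` and `θ(f) = 0` factors through the determinant. -/
theorem statement6
    (hodd : Odd p)
    (σ₂ : (KZsub p) →* (SymSpace p ≃ₗ[AlgebraicClosure (ZMod p)] SymSpace p))
    (hσK : ∀ (u : (Matrix (Fin 2) (Fin 2) ℤ_[p])ˣ) (hu : glOfZ p u ∈ KZsub p)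
      (F : SymSpace p),
      ((σ₂ ⟨glOfZ p u, hu⟩ F : MvPolynomial (Fin 2) (AlgebraicClosure (ZMod p))))
        = symSubstAct p ((u : Matrix (Fin 2) (Fin 2) ℤ_[p]).map (PadicInt.toZMod))
            (F : MvPolynomial (Fin 2) (AlgebraicClosure (ZMod p))))
    (π : ℚ_[p]ˣ) (hπ : (π : ℚ_[p]) = (p : ℚ_[p]))
    (hσp : ∀ hmem : scalarGLQp p π ∈ KZsub p, σ₂ ⟨scalarGLQp p π, hmem⟩ = 1)
    (α : GL (Fin 2) ℚ_[p])
    (hα : (α : Matrix (Fin 2) (Fin 2) ℚ_[p]) = !![1, 0; 0, ((p : ℚ_[p]))⁻¹])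
    -- the Barthel–Livné function `φ_T` for the trivial representation
    (φT1 : GL (Fin 2) ℚ_[p] → (AlgebraicClosure (ZMod p) →ₗ[AlgebraicClosure (ZMod p)]
      AlgebraicClosure (ZMod p)))
    (hφT1supp : ∀ g, (¬ ∃ h₁ ∈ KZsub p, ∃ h₂ ∈ KZsub p, g = h₁ * α * h₂) → φT1 g = 0)
    (hφT1equiv : ∀ (h₁ h₂ : KZsub p) (g), φT1 (↑h₁ * g * ↑h₂) = φT1 g)
    (hφT1α : φT1 α = LinearMap.id)
    -- the Barthel–Livné function `φ_T` for `Sym^{p-1}(F̄_p²)`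
    (φT2 : GL (Fin 2) ℚ_[p] →
      (SymSpace p →ₗ[AlgebraicClosure (ZMod p)] SymSpace p))
    (hφT2supp : ∀ g, (¬ ∃ h₁ ∈ KZsub p, ∃ h₂ ∈ KZsub p, g = h₁ * α * h₂) → φT2 g = 0)
    (hφT2equiv : ∀ (h₁ h₂ : KZsub p) (g),
      φT2 (↑h₁ * g * ↑h₂) = (σ₂ h₁).toLinearMap ∘ₗ φT2 g ∘ₗ (σ₂ h₂).toLinearMap)
    (hφT2α : ∀ F : SymSpace p,
      ((φT2 α F : MvPolynomial (Fin 2) (AlgebraicClosure (ZMod p))))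
        = MvPolynomial.aeval ![0, MvPolynomial.X 1]
            (F : MvPolynomial (Fin 2) (AlgebraicClosure (ZMod p))))
    -- the transpose Hecke operator on `ind 1`
    (T1' : (GL (Fin 2) ℚ_[p] → AlgebraicClosure (ZMod p)) →
      (GL (Fin 2) ℚ_[p] → AlgebraicClosure (ZMod p)))
    (hT1' : ∀ F ∈ indOne p, T1' F ∈ indOne p ∧
      ∀ f ∈ cIndOne p, pairingOne p (heckeT p φT1 f) F = pairingOne p f (T1' F))
    -- the transpose Hecke operator on `ind (Sym^{p-1})*`
    (T2' : (GL (Fin 2) ℚ_[p] → Module.Dual (AlgebraicClosure (ZMod p)) (SymSpace p)) →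
      (GL (Fin 2) ℚ_[p] → Module.Dual (AlgebraicClosure (ZMod p)) (SymSpace p)))
    (hT2' : ∀ F ∈ indDualSym p σ₂, T2' F ∈ indDualSym p σ₂ ∧
      ∀ f ∈ cIndSym p σ₂, pairingSym p (heckeT p φT2 f) F = pairingSym p f (T2' F)) :
    ∃ θ : (GL (Fin 2) ℚ_[p] → AlgebraicClosure (ZMod p)) →
        (GL (Fin 2) ℚ_[p] → Module.Dual (AlgebraicClosure (ZMod p)) (SymSpace p)),
      -- `θ` maps `ind 1` to `ind (Sym^{p-1})*`
      (∀ F ∈ indOne p, θ F ∈ indDualSym p σ₂) ∧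
      -- `θ` is `F̄_p`-linear
      (∀ F ∈ indOne p, ∀ F' ∈ indOne p, θ (F + F') = θ F + θ F') ∧
      (∀ a : AlgebraicClosure (ZMod p), ∀ F ∈ indOne p, θ (a • F) = a • θ F) ∧
      -- `θ` is `G`-equivariant for the right-translation actions
      (∀ F ∈ indOne p, ∀ g : GL (Fin 2) ℚ_[p],
        θ (fun y => F (y * g)) = fun y => θ F (y * g)) ∧
      -- `θ ∘ T = T ∘ θ`
      (∀ F ∈ indOne p, θ (T1' F) = T2' (θ F)) ∧
      -- eigenvectors in the kernel factor through the determinant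
      (∀ lam : AlgebraicClosure (ZMod p), ∀ F ∈ indOne p,
        T1' F = lam • F → θ F = 0 →
        ∃ F₀ : ℚ_[p] → AlgebraicClosure (ZMod p),
          ∀ g : GL (Fin 2) ℚ_[p], F g = F₀ ((g : Matrix (Fin 2) (Fin 2) ℚ_[p]).det)) := by
  classical
  have hφ1 : ∀ (x : GL (Fin 2) ℚ_[p]) (h : KZsub p) (w : AlgebraicClosure (ZMod p)),
      φT1 (x * h) w = φT1 x ((1 : KZsub p →* (AlgebraicClosure (ZMod p)
        ≃ₗ[AlgebraicClosure (ZMod p)] AlgebraicClosure (ZMod p))) h w) := by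
    intro x h w
    have := hφT1equiv 1 h x
    rw [Subgroup.coe_one, one_mul] at this
    rw [this]
    rfl
  have hφ2 : ∀ (x : GL (Fin 2) ℚ_[p]) (h : KZsub p) (w : SymSpace p),
      φT2 (x * h) w = φT2 x (σ₂ h w) := by
    intro x h w
    have := hφT2equiv 1 h x
    rw [Subgroup.coe_one, one_mul, map_one] at this
    rw [this]
    rfl
  have hsupp1 : ∀ x, φT1 x ≠ 0 → ∃ h₁ ∈ KZsub p, ∃ h₂ ∈ KZsub p, x = h₁ * α * h₂ :=
    fun x hx => not_not.mp (mt (hφT1supp x) hx)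
  have hsupp2 : ∀ x, φT2 x ≠ 0 → ∃ h₁ ∈ KZsub p, ∃ h₂ ∈ KZsub p, x = h₁ * α * h₂ :=
    fun x hx => not_not.mp (mt (hφT2supp x) hx)
  have hT1 : ∀ F ∈ indOne p, ∀ g,
      T1' F g = - ∑ r : Fin 2 → ZMod p with r ≠ 0, F (nbr α r * g) := by
    intro F hF g
    obtain ⟨hmem, hadj⟩ := hT1' F hF
    have h := transpose_hecke_apply 1 φT1 hφ1 (fun x => F x • LinearMap.id)
      (fun x => T1' F x • LinearMap.id)
      (fun h x v => by
        change T1' F (h * x) • v = T1' F x • v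
        rw [hmem h x])
      (fun f hf hfin => by
        simp only [LinearMap.smul_apply, LinearMap.id_apply, smul_eq_mul]
        exact hadj f ⟨hf, hfin⟩) g 1
    have h' : T1' F g = ∑ᶠ c : Quotient (QuotientGroup.rightRel (KZsub p)),
        F c.out * φT1 (c.out * g⁻¹) 1 := by simpa using h
    rw [h', finsum_double_coset α hα (fun x => F x * φT1 (x * g⁻¹) 1) (g := g)]
    · congr 1
      refine Finset.sum_congr rfl fun r _ => ?_
      have e := hφ1 α ⟨glOfZ p (liftRow r), glOfZ_mem _⟩ 1
      rw [hφT1α] at e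
      change φT1 (nbr α r) 1 = 1 at e
      rw [mul_inv_cancel_right, e, mul_one]
    · intro h x
      have e := hφT1equiv h 1 (x * g⁻¹)
      rw [Subgroup.coe_one, mul_one] at e
      rw [hF h x, mul_assoc, e]
    · intro x hx
      exact hsupp1 _ fun h0 => hx (by simp [h0])
  have hT2 : ∀ F ∈ indDualSym p σ₂, ∀ g v,
      T2' F g v = - ∑ r : Fin 2 → ZMod p with r ≠ 0, F (nbr α r * g) (φT2 (nbr α r) v) := by
    intro F hF g v
    obtain ⟨hmem, hadj⟩ := hT2' F hF
    rw [transpose_hecke_apply σ₂ φT2 hφ2 F (T2' F) hmem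
      (fun f hf hfin => hadj f ⟨hf, hfin⟩) g v,
      finsum_double_coset α hα (fun x => F x (φT2 (x * g⁻¹) v)) (g := g)]
    · simp only [mul_inv_cancel_right]
    · intro h x
      have e := hφT2equiv h 1 (x * g⁻¹)
      rw [Subgroup.coe_one, mul_one, map_one] at e
      rw [hF h x, mul_assoc, e]
      exact congrArg (F x) ((σ₂ h).symm_apply_apply _)
    · intro x hx
      exact hsupp2 _ fun h0 => hx (by simp [h0])
  refine ⟨theta α, fun F hF => theta_mem α hα σ₂ hσK π hπ hσp hF, ?_, ?_, ?_, ?_, ?_⟩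
  · intro F _ F' _
    funext g
    ext1 v
    simp [theta_apply, add_mul, Finset.sum_add_distrib]
  · intro a F _
    funext g
    ext1 v
    simp [theta_apply, Finset.mul_sum, mul_assoc]
  · intro F _ g
    funext y
    simp only [theta, mul_assoc]
  · intro F hF
    funext g
    refine LinearMap.ext fun v => ?_
    rw [theta_apply, hT2 _ (theta_mem α hα σ₂ hσK π hπ hσp hF)]
    have h2 : ∀ r : Fin 2 → ZMod p, r ≠ 0 →
        theta α F (nbr α r * g) (φT2 (nbr α r) v) =
          (∑ s : Fin 2 → ZMod p, if s 1 = 0 then 0 else F (nbr α s * (nbr α r * g))) *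
            evRow r v := by
      intro r hr
      rw [theta_apply, Finset.sum_mul]
      refine Finset.sum_congr rfl fun s _ => ?_
      rw [evRow_phi_nbr α σ₂ hσK φT2 hφT2α hφ2 hr]
      split_ifs <;> simp
    have h3 : ∑ r : Fin 2 → ZMod p with r ≠ 0,
        (∑ s : Fin 2 → ZMod p, if s 1 = 0 then 0 else F (nbr α s * (nbr α r * g))) * evRow r v =
          ∑ r : Fin 2 → ZMod p,
            (∑ s : Fin 2 → ZMod p, if s 1 = 0 then 0 else F (nbr α s * (nbr α r * g))) *
              evRow r v :=
      Finset.sum_filter_of_ne fun r _ h hr => h (by rw [hr, evRow_zero, mul_zero])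
    rw [Finset.sum_congr rfl fun r hr => h2 r (Finset.mem_filter.mp hr).2, h3, ← sub_eq_zero, sub_neg_eq_add, ← Finset.sum_add_distrib]
    calc _ = ∑ r : Fin 2 → ZMod p, F g * evRow r v := by
          refine Finset.sum_congr rfl fun r _ => ?_
          rw [hT1 F hF, sum_nbr_nbr α hα hF]
          ring
      _ = 0 := by rw [← Finset.mul_sum, sum_evRow, mul_zero]
  · intro _ F hF _ hθ
    exact factors_through_det_of_theta_eq_zero α hα hF hθ
end

section
/- Let Γ be a group having a finite normal subgroup G such that Γ/G is infinite cyclic. Let A be a commutative local ℚ_p-algebra with maximal ideal m_A, and let I ⊆ A be an ideal with I·m_A = 0. Then every representation of Γ on a finite free A/I-module lifts to A: if D̄ is a finite free A/I-module equipped with an A/I-linear action ρ̄ of Γ, then there exist a finite free A-module D, an A-linear action ρ of Γ on D, and an A/I-linear Γ-equivariant isomorphism D/ID ≅ D̄. -/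
/-- A representation of a group `Γ` on a finite free module over a commutative ring `A`. -/
structure FiniteFreeRep (A : Type) [CommRing A] (Γ : Type) [Group Γ] where
  D : Type
  [iAdd : AddCommGroup D]
  [iMod : Module A D]
  [iFree : Module.Free A D]
  [iFin : Module.Finite A D]
  ρ : Γ →* (D ≃ₗ[A] D)

attribute [instance] FiniteFreeRep.iAdd FiniteFreeRep.iMod FiniteFreeRep.iFree FiniteFreeRep.iFin

/-- A lift of a unit along a surjective ring homomorphism with square-zero kernel is a unit. -/
theorem isUnit_of_map_isUnit {R S : Type*} [Ring R] [Ring S] (π : R →+* S)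
    (hπ : Function.Surjective π) (hsq : ∀ x y, π x = 0 → π y = 0 → x * y = 0)
    {r : R} (hr : IsUnit (π r)) : IsUnit r := by
  obtain ⟨u, hu⟩ := hr
  obtain ⟨r', hr'⟩ := hπ (↑u⁻¹ : S)
  have h1 := hsq (r * r' - 1) (r * r' - 1) (by simp [← hu, hr']) (by simp [← hu, hr'])
  have h2 := hsq (r' * r - 1) (r' * r - 1) (by simp [← hu, hr']) (by simp [← hu, hr'])
  refine isUnit_iff_exists_and_exists.2 ⟨⟨r' * (2 - r * r'), ?_⟩, ⟨(2 - r' * r) * r', ?_⟩⟩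
  · rw [← sub_eq_zero, ← neg_eq_zero, ← h1]
    noncomm_ring
  · rw [← sub_eq_zero, ← neg_eq_zero, ← h2]
    noncomm_ring

/-- Vanishing of the `H²` obstruction for a finite group: a multiplicative map to `S` lifts along
a surjection of rings `R → S` with square-zero kernel, when `R` is a `ℚ`-algebra. -/
theorem exists_monoidHom_lift_of_finite {R S : Type*} [Ring R] [Algebra ℚ R] [Ring S]
    (π : R →+* S) (hπ : Function.Surjective π)
    (hsq : ∀ x y, π x = 0 → π y = 0 → x * y = 0)
    {G : Type*} [Group G] [Finite G] (f : G →* S) :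
    ∃ σ : G →* R, ∀ g, π (σ g) = f g := by
  have := Fintype.ofFinite G
  choose s hs using fun g => hπ (f g)
  set δ : G → G → R := fun g h => s g * s h - s (g * h) with hδ
  have hδ0 (g h : G) : π (δ g h) = 0 := by simp [hδ, hs]
  set c : ℚ := (Fintype.card G : ℚ)⁻¹ with hc
  set B : G → R := fun g => c • ∑ k, δ g k * s k⁻¹ with hB
  have hB0 (g : G) : π (B g) = 0 := by
    simp only [hB, Algebra.smul_def, map_mul, map_sum, hδ0, zero_mul, Finset.sum_const_zero,
      mul_zero]
  have hright (x r r' : R) (hx : π x = 0) (hr : π r = π r') : x * r = x * r' := by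
    rw [← sub_eq_zero, ← mul_sub]
    exact hsq _ _ hx (by simp [hr])
  have hshift (g h : G) : ∑ k, δ g (h * k) * s k⁻¹ = (∑ k, δ g k * s k⁻¹) * s h := by
    rw [Finset.sum_mul]
    refine Fintype.sum_equiv (Equiv.mulLeft h) _ _ fun k => ?_
    rw [mul_assoc, Equiv.coe_mulLeft]
    exact hright _ _ _ (hδ0 _ _) (by rw [map_mul, hs, hs, hs, ← map_mul]; simp)
  have hconst (g h : G) : ∑ k, δ g h * s k * s k⁻¹ = (Fintype.card G : ℚ) • δ g h := by
    have (k : G) : δ g h * s k * s k⁻¹ = δ g h := by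
      rw [mul_assoc, hright _ _ 1 (hδ0 g h) (by rw [map_mul, hs, hs, ← map_mul]; simp), mul_one]
    simp [this, Nat.cast_smul_eq_nsmul]
  have hcocycle (g h : G) : s g * B h - B (g * h) + B g * s h = δ g h := by
    have key : s g * (∑ k, δ h k * s k⁻¹) - ∑ k, δ (g * h) k * s k⁻¹
        + (∑ k, δ g k * s k⁻¹) * s h = (Fintype.card G : ℚ) • δ g h := by
      rw [← hshift, ← hconst, Finset.mul_sum, ← Finset.sum_sub_distrib, ← Finset.sum_add_distrib]
      refine Finset.sum_congr rfl fun k _ => ?_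
      simp only [hδ, mul_assoc g h k]
      noncomm_ring
    simp only [hB, mul_smul_comm, smul_mul_assoc, ← smul_sub, ← smul_add, key]
    rw [smul_smul, hc, inv_mul_cancel₀ (by simp), one_smul]
  have hmul (g h : G) : s (g * h) - B (g * h) = (s g - B g) * (s h - B h) := by
    have h1 := hcocycle g h
    have h2 := hsq _ _ (hB0 g) (hB0 h)
    have h3 : (s g - B g) * (s h - B h)
        = s g * s h - (s g * B h - B (g * h) + B g * s h) - B (g * h) + B g * B h := by
      noncomm_ring
    rw [h3, h1, h2]
    simp only [hδ]
    abel
  have hone : s 1 - B 1 = 1 := by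
    have hunit : IsUnit (s 1 - B 1) :=
      isUnit_of_map_isUnit π hπ hsq (by simp [hs, hB0])
    have := hmul 1 1
    rw [mul_one] at this
    exact hunit.mul_left_cancel (by rw [← this, mul_one])
  exact ⟨⟨⟨fun g => s g - B g, hone⟩, hmul⟩, fun g => by simp [hs, hB0]⟩

/-- Vanishing of `H¹` for a finite group: two lifts along a square-zero extension of `ℚ`-algebras
are conjugate by a unit reducing to `1`. -/
theorem exists_unit_conj_of_lifts {R S : Type*} [Ring R] [Algebra ℚ R] [Ring S]
    (π : R →+* S) (hπ : Function.Surjective π)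
    (hsq : ∀ x y, π x = 0 → π y = 0 → x * y = 0)
    {G : Type*} [Group G] [Finite G] (σ τ : G →* R) (h : ∀ g, π (σ g) = π (τ g)) :
    ∃ u : Rˣ, π u = 1 ∧ ∀ g, σ g * u = u * τ g := by
  have := Fintype.ofFinite G
  set c : ℚ := (Fintype.card G : ℚ)⁻¹ with hc
  set v : R := c • ∑ k, σ k * τ k⁻¹ with hv
  have hπv : π v = 1 := by
    have h1 : π (∑ k, σ k * τ k⁻¹) = π ((Fintype.card G : ℚ) • 1) := by
      have (k : G) : π (σ k * τ k⁻¹) = 1 := by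
        rw [map_mul, h, ← map_mul, ← map_mul, mul_inv_cancel, map_one, map_one]
      simp only [map_sum, this]
      simp [Nat.cast_smul_eq_nsmul]
    rw [hv, Algebra.smul_def, map_mul, h1, ← map_mul, ← Algebra.smul_def, smul_smul, hc,
      inv_mul_cancel₀ (by simp), one_smul, map_one]
  have hunit : IsUnit v := isUnit_of_map_isUnit π hπ hsq (by simp [hπv])
  refine ⟨hunit.unit, hπv, fun g => ?_⟩
  rw [IsUnit.unit_spec, hv, mul_smul_comm, smul_mul_assoc, Finset.mul_sum, Finset.sum_mul]
  congr 1
  refine Fintype.sum_equiv (Equiv.mulLeft g) _ _ fun k => ?_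
  rw [Equiv.coe_mulLeft, map_mul, mul_inv_rev, map_mul, mul_assoc, mul_assoc, mul_assoc, ← map_mul,
    inv_mul_cancel, map_one, mul_one]

/-- A homomorphism on a normal subgroup `G` with infinite cyclic quotient extends to the whole
group as soon as conjugation by a lift `t` of the generator is intertwined by a unit `T`. -/
theorem exists_extension_of_conj {Γ U : Type*} [Group Γ] [Group U] (G : Subgroup Γ) [G.Normal]
    (q : Γ →* Multiplicative ℤ) (hq : q.ker = G) (t : Γ) (ht : q t = Multiplicative.ofAdd 1)
    (σ : G →* U) (T : U) (hT : ∀ g : G, T * σ g * T⁻¹ = σ (MulAut.conjNormal t g)) :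
    ∃ F : Γ →* U, (∀ g : G, F g = σ g) ∧ F t = T := by
  have hTn (n : ℤ) (g : G) : T ^ n * σ g * (T ^ n)⁻¹ = σ (MulAut.conjNormal (t ^ n) g) := by
    have hT' (g : G) : T⁻¹ * σ g * T = σ (MulAut.conjNormal t⁻¹ g) := by
      have := hT (MulAut.conjNormal t⁻¹ g)
      rw [← MulAut.mul_apply, ← map_mul, mul_inv_cancel, map_one, MulAut.one_apply] at this
      rw [← this]
      group
    induction n with
    | zero => simp
    | succ n ih =>
      rw [add_comm, zpow_add, zpow_add, map_mul, MulAut.mul_apply, zpow_one, zpow_one, ← hT, ← ih]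
      group
    | pred n ih =>
      rw [sub_eq_neg_add, zpow_add, zpow_add, map_mul, MulAut.mul_apply, zpow_neg_one,
        zpow_neg_one, ← hT', ← ih]
      group
  set n : Γ → ℤ := fun γ => (q γ).toAdd with hn
  have hnmul (γ γ' : Γ) : n (γ * γ') = n γ + n γ' := by simp [hn]
  have hmem (γ : Γ) : γ * (t ^ n γ)⁻¹ ∈ G := by
    rw [← hq, MonoidHom.mem_ker, map_mul, map_inv, map_zpow, ht, ← ofAdd_zsmul]
    simp [hn]
  have hnG (g : G) : n g = 0 := by
    have : q g = 1 := MonoidHom.mem_ker.1 (hq ▸ g.2)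
    simp [hn, this]
  refine ⟨MonoidHom.mk' (fun γ => σ ⟨γ * (t ^ n γ)⁻¹, hmem γ⟩ * T ^ n γ) fun γ γ' => ?_,
    fun g => ?_, ?_⟩
  · have h1 : (⟨γ * γ' * (t ^ n (γ * γ'))⁻¹, hmem _⟩ : G) = ⟨γ * (t ^ n γ)⁻¹, hmem γ⟩ *
        MulAut.conjNormal (t ^ n γ) ⟨γ' * (t ^ n γ')⁻¹, hmem γ'⟩ := by
      ext
      simp only [Subgroup.coe_mul, MulAut.conjNormal_apply, hnmul, zpow_add, mul_inv_rev]
      rw [← mul_inv_rev, ← zpow_add, add_comm, zpow_add]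
      group
    rw [h1, map_mul, ← hTn, hnmul, zpow_add]
    group
  · simp [hnG]
  · have h1 : n t = 1 := by simp [hn, ht]
    have h2 : (⟨t * (t ^ n t)⁻¹, hmem t⟩ : G) = 1 := by
      ext
      simp [h1]
    rw [MonoidHom.mk'_apply, h2, map_one, one_mul, h1, zpow_one]

/-- Two homomorphisms that agree on a normal subgroup with infinite cyclic quotient and on a lift
of the generator are equal. -/
theorem monoidHom_eq_of_eq_on_generators {Γ S : Type*} [Group Γ] [Monoid S] (G : Subgroup Γ)
    (q : Γ →* Multiplicative ℤ) (hq : q.ker = G) (t : Γ) (ht : q t = Multiplicative.ofAdd 1)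
    (f f' : Γ →* S) (hG : ∀ g : G, f g = f' g) (h : f t = f' t) : f = f' := by
  have htop : Subgroup.closure (insert t (G : Set Γ)) = ⊤ := by
    refine eq_top_iff.2 fun γ _ => ?_
    have hγ : γ * (t ^ (q γ).toAdd)⁻¹ ∈ G := by
      rw [← hq, MonoidHom.mem_ker, map_mul, map_inv, map_zpow, ht, ← ofAdd_zsmul]
      simp
    have := mul_mem (Subgroup.subset_closure (Set.mem_insert_of_mem t hγ))
      (zpow_mem (Subgroup.subset_closure (Set.mem_insert t (G : Set Γ))) (q γ).toAdd)
    simpa using this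
  refine MonoidHom.eq_of_eqOn_top (f := f) (g := f') fun γ _ => ?_
  have : Set.EqOn f f' (Subgroup.closure (insert t (G : Set Γ))) :=
    MonoidHom.eqOn_closure fun γ hγ => by
      rcases hγ with rfl | hγ
      exacts [h, hG ⟨γ, hγ⟩]
  exact this (htop ▸ Subgroup.mem_top γ)

/-- Unobstructed lifting for a finite-by-`ℤ` group along a square-zero extension of
`ℚ`-algebras. -/
theorem exists_monoidHom_lift_of_finite_by_int {R S : Type*} [Ring R] [Algebra ℚ R] [Ring S]
    (π : R →+* S) (hπ : Function.Surjective π)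
    (hsq : ∀ x y, π x = 0 → π y = 0 → x * y = 0)
    {Γ : Type*} [Group Γ] (G : Subgroup Γ) [G.Normal] [Finite G]
    (e : (Γ ⧸ G) ≃* Multiplicative ℤ) (f : Γ →* S) :
    ∃ F : Γ →* R, ∀ γ, π (F γ) = f γ := by
  set q : Γ →* Multiplicative ℤ := e.toMonoidHom.comp (QuotientGroup.mk' G) with hqdef
  have hq : q.ker = G := by
    ext γ
    simp [hqdef]
  obtain ⟨t, ht⟩ : ∃ t, q t = Multiplicative.ofAdd 1 :=
    (e.surjective.comp (QuotientGroup.mk'_surjective G)) _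
  obtain ⟨σ, hσ⟩ := exists_monoidHom_lift_of_finite π hπ hsq (f.comp G.subtype)
  obtain ⟨r, hr⟩ := hπ (f t)
  obtain ⟨T, rfl⟩ : IsUnit r :=
    isUnit_of_map_isUnit π hπ hsq (hr ▸ (Group.isUnit t).map f)
  have hTinv : π ↑T⁻¹ = f t⁻¹ := by
    have h1 : f t * π ↑T⁻¹ = 1 := by rw [← hr, ← map_mul, T.mul_inv, map_one]
    rw [← one_mul (π _), ← map_one f, ← inv_mul_cancel t, map_mul, mul_assoc, h1, mul_one]
  let σ' : G →* Rˣ := σ.toHomUnits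
  let τ : G →* Rˣ :=
    ((MulAut.conj T).toMonoidHom.comp σ').comp (MulAut.conjNormal t⁻¹ : MulAut G).toMonoidHom
  have hτ (g : G) : τ g = T * σ' (MulAut.conjNormal t⁻¹ g) * T⁻¹ := rfl
  obtain ⟨u, hu, hconj⟩ := exists_unit_conj_of_lifts π hπ hsq σ ((Units.coeHom R).comp τ)
    fun g => by
      rw [MonoidHom.comp_apply, Units.coeHom_apply, hτ, Units.val_mul, Units.val_mul, map_mul,
        map_mul, hTinv, hr, MonoidHom.coe_toHomUnits, hσ, hσ, MonoidHom.comp_apply,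
        MonoidHom.comp_apply, ← map_mul, ← map_mul, Subgroup.coe_subtype, MulAut.conjNormal_apply]
      congr 1
      group
  have hconj' (g : G) : σ' g * u = u * τ g := Units.ext (hconj g)
  obtain ⟨F, hFG, hFt⟩ := exists_extension_of_conj G q hq t ht σ' (u * T) fun g => by
    have h1 := hconj' (MulAut.conjNormal t g)
    rw [hτ, ← MulAut.mul_apply, ← map_mul, inv_mul_cancel, map_one, MulAut.one_apply] at h1
    rw [← mul_inv_eq_iff_eq_mul.2 h1.symm]
    group
  have : ((π : R →* S).comp (Units.coeHom R)).comp F = f := by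
    refine monoidHom_eq_of_eq_on_generators G q hq t ht _ _ (fun g => ?_) ?_
    · simp [hFG, σ', hσ]
    · simp [hFt, hu, hr]
  exact ⟨(Units.coeHom R).comp F, fun γ => DFunLike.congr_fun this γ⟩

/-- A vector lies in `I • ⊤` exactly when all its coordinates lie in `I`. -/
theorem mem_ideal_smul_top_pi_iff {A ι : Type*} [CommRing A] [Finite ι] (I : Ideal A)
    (x : ι → A) : x ∈ (I • ⊤ : Submodule A (ι → A)) ↔ ∀ i, x i ∈ I := by
  have := Fintype.ofFinite ι
  classical
  refine ⟨fun hx i => ?_, fun hx => ?_⟩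
  · refine Submodule.smul_induction_on hx (fun a ha y _ => I.mul_mem_right (y i) ha)
      fun y z hy hz => I.add_mem hy hz
  · rw [pi_eq_sum_univ' x]
    exact Submodule.sum_mem _ fun i _ => Submodule.smul_mem_smul (hx i) trivial

/-- **Unobstructed lifting of representations of a finite-by-ℤ group.**
Let `Γ` be a group with a finite normal subgroup `G` such that `Γ ⧸ G` is infinite cyclic.
Let `A` be a commutative local `ℚ_p`-algebra with maximal ideal `m_A` and `I ⊆ A` an ideal
with `I·m_A = 0`.  Then every representation of `Γ` on a finite free `A/I`-module `D̄`
lifts to a representation on a finite free `A`-module `D`, in the sense that there is a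
surjective additive map `red : D → D̄`, semilinear over `A → A/I`, with kernel `I•D`,
which is `Γ`-equivariant (this encodes an `A/I`-linear `Γ`-equivariant isomorphism
`D/ID ≅ D̄`). -/
theorem statement10
    (p : ℕ) [Fact p.Prime]
    (Γ : Type) [Group Γ] (G : Subgroup Γ) [G.Normal] [Finite G]
    (hcyc : Nonempty ((Γ ⧸ G) ≃* Multiplicative ℤ))
    (A : Type) [CommRing A] [Algebra ℚ_[p] A] [IsLocalRing A]
    (I : Ideal A) (hI : I * IsLocalRing.maximalIdeal A = ⊥)
    (Dbar : Type) [AddCommGroup Dbar] [Module (A ⧸ I) Dbar]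
    [Module.Free (A ⧸ I) Dbar] [Module.Finite (A ⧸ I) Dbar]
    (ρbar : Γ →* (Dbar ≃ₗ[A ⧸ I] Dbar)) :
    ∃ (M : FiniteFreeRep A Γ) (red : M.D →+ Dbar),
      Function.Surjective red ∧
      (∀ (a : A) (x : M.D), red (a • x) = Ideal.Quotient.mk I a • red x) ∧
      (∀ x : M.D, red x = 0 ↔ x ∈ (I • ⊤ : Submodule A M.D)) ∧
      (∀ (γ : Γ) (x : M.D), red (M.ρ γ x) = ρbar γ (red x)) := by
  obtain ⟨e⟩ := hcyc
  by_cases hItop : I = ⊤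
  · have : Subsingleton (A ⧸ I) := Ideal.Quotient.subsingleton_iff.2 hItop
    have : Subsingleton Dbar := Module.subsingleton (A ⧸ I) Dbar
    exact ⟨⟨PUnit, 1⟩, 0, fun y => ⟨0, Subsingleton.elim _ _⟩, fun _ _ => Subsingleton.elim _ _,
      fun x => ⟨fun _ => Subsingleton.elim 0 x ▸ zero_mem _, fun _ => rfl⟩,
      fun _ _ => Subsingleton.elim _ _⟩
  classical
  have hIsq (x y : A) (hx : x ∈ I) (hy : y ∈ I) : x * y = 0 := by
    have := Ideal.mul_mem_mul hx (IsLocalRing.le_maximalIdeal hItop hy)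
    rwa [hI, Ideal.mem_bot] at this
  let b := Module.Free.chooseBasis (A ⧸ I) Dbar
  let ι := Module.Free.ChooseBasisIndex (A ⧸ I) Dbar
  let mk := Ideal.Quotient.mk I
  let : Algebra ℚ A := Algebra.compHom A (algebraMap ℚ ℚ_[p])
  let π : Matrix ι ι A →+* Matrix ι ι (A ⧸ I) := mk.mapMatrix
  have hπ : Function.Surjective π := fun M => by
    choose N hN using fun i j => Ideal.Quotient.mk_surjective (M i j)
    exact ⟨Matrix.of N, by ext i j; exact hN i j⟩
  have hπ0 (M : Matrix ι ι A) (hM : π M = 0) (i j : ι) : M i j ∈ I :=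
    Ideal.Quotient.eq_zero_iff_mem.1 (congrFun (congrFun hM i) j)
  have hsq (M N : Matrix ι ι A) (hM : π M = 0) (hN : π N = 0) : M * N = 0 := by
    ext i j
    exact Finset.sum_eq_zero fun k _ => hIsq _ _ (hπ0 M hM i k) (hπ0 N hN k j)
  let f : Γ →* Matrix ι ι (A ⧸ I) :=
    ((LinearMap.toMatrixAlgEquiv b : _ →* _).comp
      (LinearEquiv.automorphismGroup.toLinearMapMonoidHom)).comp ρbar
  have hf (γ : Γ) : f γ = LinearMap.toMatrix b b (ρbar γ) := rfl
  obtain ⟨F, hF⟩ := exists_monoidHom_lift_of_finite_by_int π hπ hsq G e f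
  let ρ : Γ →* ((ι → A) ≃ₗ[A] (ι → A)) :=
    (LinearMap.GeneralLinearGroup.generalLinearEquiv A (ι → A)).toMonoidHom.comp
      (((Matrix.toLinAlgEquiv' : Matrix ι ι A ≃ₐ[A] _) : _ →* _).comp F).toHomUnits
  have hρ (γ : Γ) (x : ι → A) : ρ γ x = (F γ).mulVec x := rfl
  let red : (ι → A) →+ Dbar :=
    (b.equivFun.symm : (ι → A ⧸ I) →+ Dbar).comp (mk.toAddMonoidHom.compLeft ι)
  have hred (x : ι → A) : red x = b.equivFun.symm (mk ∘ x) := rfl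
  refine ⟨⟨ι → A, ρ⟩, red, fun y => ?_, fun a x => ?_, fun x => ?_, fun γ x => ?_⟩
  · choose x hx using fun i => Ideal.Quotient.mk_surjective (b.equivFun y i)
    refine ⟨x, ?_⟩
    rw [hred, LinearEquiv.symm_apply_eq]
    exact funext hx
  · rw [hred, hred, ← map_smul]
    congr 1
  · rw [hred, LinearEquiv.map_eq_zero_iff, mem_ideal_smul_top_pi_iff, funext_iff]
    exact forall_congr' fun i => Ideal.Quotient.eq_zero_iff_mem
  · change red (ρ γ x) = _
    rw [hred, hred, LinearEquiv.symm_apply_eq, hρ]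
    have h1 : mk ∘ (F γ).mulVec x = (π (F γ)).mulVec (mk ∘ x) :=
      funext fun i => RingHom.map_mulVec mk (F γ) x i
    have h2 := LinearMap.toMatrix_mulVec_repr b b (ρbar γ : Dbar →ₗ[A ⧸ I] Dbar)
      (b.equivFun.symm (mk ∘ x))
    rw [h1, hF, hf]
    rw [← b.equivFun_apply, LinearEquiv.apply_symm_apply] at h2
    exact h2
end
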